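/- arXiv:1503.05799 — 10 statements merged into one kernel-verified Lean document; each statement's English description precedes it below -/
import Mathlib

section
/- Let K be a field, n and r positive integers with r ≤ n, and let A be an n×n matrix over K with rank A = r. Let i, j : Fin r ↪ Fin n be injections (row and column index sets) such that the r×r submatrix A.submatrix i j is invertible. Then there exists a unique pair (B, C), with B an n×r matrix and C an r×n matrix over K, such that B.submatrix i id is the r×r identity matrix, C.submatrix id j is the r×r identity matrix, and A = B * (A.submatrix i j) * C. -/
open Matrix in
/-- If the `i × j` submatrix of `A` is invertible of size the rank of `A`, then the columns of `A`
indexed by `j` span the column space of `A`. -/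
theorem Matrix.exists_eq_submatrix_mul_of_isUnit {K m n ι : Type*} [Field K] [Fintype m]
    [Fintype n] [Fintype ι] [DecidableEq ι] (A : Matrix m n K) (i : ι → m) (j : ι → n)
    (hrank : A.rank = Fintype.card ι) (hinv : IsUnit (A.submatrix i j)) :
    ∃ X : Matrix ι n K, A = A.submatrix id j * X := by
  classical
  have hle : LinearMap.range (A.submatrix id j).mulVecLin ≤ LinearMap.range A.mulVecLin := by
    rw [range_mulVecLin, range_mulVecLin]
    refine Submodule.span_mono ?_
    rintro _ ⟨k, rfl⟩
    exact ⟨j k, rfl⟩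
  have hge : A.rank ≤ (A.submatrix id j).rank := by
    rw [hrank, ← rank_of_isUnit _ hinv]
    exact rank_submatrix_le (A.submatrix id j) i id
  have hrange := Submodule.eq_of_le_of_finrank_le hle hge
  have hcol (k : n) : ∃ x : ι → K, A.submatrix id j *ᵥ x = A.col k := by
    have hmem : A.col k ∈ LinearMap.range A.mulVecLin := by
      rw [range_mulVecLin]
      exact Submodule.subset_span ⟨k, rfl⟩
    rw [← hrange] at hmem
    exact hmem
  choose x hx using hcol
  refine ⟨of fun l k => x k l, ?_⟩
  ext l k
  exact (congrFun (hx k) l).symm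

/-- The normalized factorization of a rank `r` matrix `A = B * A(i;j) * C`,
where `B` is normalized with respect to the row indices `i` and `C` is
normalized with respect to the column indices `j`. -/
theorem stmt_0 (K : Type*) [Field K] (n r : ℕ) (hn : 0 < n) (hr : 0 < r) (hrn : r ≤ n)
    (A : Matrix (Fin n) (Fin n) K) (hrank : A.rank = r)
    (i j : Fin r ↪ Fin n) (hinv : IsUnit (A.submatrix i j)) :
    ∃! BC : Matrix (Fin n) (Fin r) K × Matrix (Fin r) (Fin n) K,
      BC.1.submatrix i id = (1 : Matrix (Fin r) (Fin r) K) ∧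
      BC.2.submatrix id j = (1 : Matrix (Fin r) (Fin r) K) ∧
      A = BC.1 * A.submatrix i j * BC.2 := by
  have hdet : IsUnit (A.submatrix i j).det := (Matrix.isUnit_iff_isUnit_det _).mp hinv
  obtain ⟨X, hX⟩ := A.exists_eq_submatrix_mul_of_isUnit i j (by simpa using hrank) hinv
  have hrows : A.submatrix i id = A.submatrix i j * X := congrArg (fun N => N.submatrix i id) hX
  refine ⟨(A.submatrix id j * (A.submatrix i j)⁻¹, (A.submatrix i j)⁻¹ * A.submatrix i id),
    ⟨?_, ?_, ?_⟩, ?_⟩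
  · exact Matrix.mul_nonsing_inv _ hdet
  · exact Matrix.nonsing_inv_mul _ hdet
  · simp only
    rw [Matrix.nonsing_inv_mul_cancel_right _ _ hdet, hrows,
      Matrix.nonsing_inv_mul_cancel_left _ _ hdet]
    exact hX
  · rintro ⟨B, C⟩ ⟨hB, hC, hA⟩
    simp only at hB hC hA
    have hcols : A.submatrix id j = B * A.submatrix i j := by
      have h : A.submatrix id j = B * A.submatrix i j * C.submatrix id j :=
        congrArg (fun N => N.submatrix id j) hA
      rwa [hC, Matrix.mul_one] at h
    have hrows' : A.submatrix i id = A.submatrix i j * C := by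
      have h : A.submatrix i id = B.submatrix i id * A.submatrix i j * C :=
        congrArg (fun N => N.submatrix i id) hA
      rwa [hB, Matrix.one_mul] at h
    rw [hcols, hrows', Matrix.mul_nonsing_inv_cancel_right _ _ hdet,
      Matrix.nonsing_inv_mul_cancel_left _ _ hdet]
end

section
/- Let K be a field, n and r positive integers with r ≤ n. Let B be an n×r matrix over K with rank B = r and C an r×n matrix over K with rank C = r. Then the map M ↦ B * M * C is a bijection from the set of invertible r×r matrices over K onto the set of n×n matrices A over K such that the column space of A equals the column space of B (i.e., LinearMap.range A.mulVecLin = LinearMap.range B.mulVecLin) and the row space of A equals the row space of C (i.e., LinearMap.range Aᵀ.mulVecLin = LinearMap.range Cᵀ.mulVecLin). -/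
open Matrix

/-- The column space of `A` lies in that of `B` iff `A` is a right multiple of `B`. -/
theorem Matrix.range_mulVecLin_le_iff_exists_mul {R l m n : Type*} [CommSemiring R]
    [Fintype m] [Fintype n] {A : Matrix l m R} {B : Matrix l n R} :
    LinearMap.range A.mulVecLin ≤ LinearMap.range B.mulVecLin ↔ ∃ X : Matrix n m R, B * X = A := by
  classical
  constructor
  · intro h
    have hcol (j : m) : ∃ x, B *ᵥ x = A.col j := by
      obtain ⟨x, hx⟩ := h (LinearMap.mem_range_self A.mulVecLin (Pi.single j 1))
      exact ⟨x, by simpa using hx⟩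
    choose x hx using hcol
    refine ⟨(Matrix.of x)ᵀ, ?_⟩
    ext i j
    exact congrFun (hx j) i
  · rintro ⟨X, rfl⟩
    rw [mulVecLin_mul]
    exact LinearMap.range_comp_le_range _ _

/-- A matrix of full row rank over a field has a right inverse. -/
theorem Matrix.exists_right_inverse_of_rank_eq_card {K m n : Type*} [Field K]
    [Fintype m] [DecidableEq m] [Fintype n] {C : Matrix m n K}
    (hC : C.rank = Fintype.card m) : ∃ R : Matrix n m K, C * R = 1 := by
  rw [← mulVec_surjective_iff_exists_right_inverse, ← coe_mulVecLin, ← LinearMap.range_eq_top]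
  exact Submodule.eq_top_of_finrank_eq (hC.trans (Module.finrank_fintype_fun_eq_card K).symm)

/-- A matrix of full column rank over a field has a left inverse. -/
theorem Matrix.exists_left_inverse_of_rank_eq_card {K m n : Type*} [Field K]
    [Fintype m] [Fintype n] [DecidableEq n] {B : Matrix m n K}
    (hB : B.rank = Fintype.card n) : ∃ L : Matrix n m K, L * B = 1 := by
  obtain ⟨R, hR⟩ := exists_right_inverse_of_rank_eq_card (B.rank_transpose.trans hB)
  exact ⟨Rᵀ, by simpa using congrArg transpose hR⟩

/-- The fibres of the bundle map `A ↦ (col A, row A)`: for `B` of full column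
rank and `C` of full row rank, `M ↦ B * M * C` is a bijection from invertible
`r × r` matrices onto `n × n` matrices with column space that of `B` and row
space that of `C`. -/
theorem stmt_1 (K : Type*) [Field K] (n r : ℕ) (hn : 0 < n) (hr : 0 < r) (hrn : r ≤ n)
    (B : Matrix (Fin n) (Fin r) K) (hB : B.rank = r)
    (C : Matrix (Fin r) (Fin n) K) (hC : C.rank = r) :
    Set.BijOn (fun M : Matrix (Fin r) (Fin r) K => B * M * C)
      {M : Matrix (Fin r) (Fin r) K | IsUnit M}
      {A : Matrix (Fin n) (Fin n) K |
        LinearMap.range A.mulVecLin = LinearMap.range B.mulVecLin ∧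
        LinearMap.range Aᵀ.mulVecLin = LinearMap.range Cᵀ.mulVecLin} := by
  obtain ⟨L, hL⟩ := exists_left_inverse_of_rank_eq_card (hB.trans (Fintype.card_fin r).symm)
  obtain ⟨R, hR⟩ := exists_right_inverse_of_rank_eq_card (hC.trans (Fintype.card_fin r).symm)
  have hcancel (M : Matrix (Fin r) (Fin r) K) : L * (B * M * C) * R = M := by
    calc L * (B * M * C) * R = (L * B) * M * (C * R) := by simp only [Matrix.mul_assoc]
      _ = M := by rw [hL, hR, Matrix.one_mul, Matrix.mul_one]
  refine ⟨?_, ?_, ?_⟩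
  · intro M hM
    obtain ⟨N, hMN⟩ := isUnit_iff_exists_inv.1 hM
    have hNM : N * M = 1 := mul_eq_one_comm.1 hMN
    refine ⟨le_antisymm ?_ ?_, le_antisymm ?_ ?_⟩ <;>
      rw [range_mulVecLin_le_iff_exists_mul]
    · exact ⟨M * C, (Matrix.mul_assoc B M C).symm⟩
    · refine ⟨R * N, ?_⟩
      calc B * M * C * (R * N) = B * (M * ((C * R) * N)) := by simp only [Matrix.mul_assoc]
        _ = B := by rw [hR, Matrix.one_mul, hMN, Matrix.mul_one]
    · exact ⟨(B * M)ᵀ, (transpose_mul _ _).symm⟩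
    · refine ⟨(N * L)ᵀ, ?_⟩
      rw [← transpose_mul]
      congr 1
      calc N * L * (B * M * C) = N * ((L * B) * M) * C := by simp only [Matrix.mul_assoc]
        _ = C := by rw [hL, Matrix.one_mul, hNM, Matrix.one_mul]
  · intro M _ M' _ h
    rw [← hcancel M, ← hcancel M']
    exact congrArg (fun A => L * A * R) h
  · rintro A ⟨hcol, hrow⟩
    obtain ⟨X, hX⟩ := range_mulVecLin_le_iff_exists_mul.1 hcol.le
    obtain ⟨Y, hY⟩ := range_mulVecLin_le_iff_exists_mul.1 hrow.le
    obtain ⟨Z, hZ⟩ := range_mulVecLin_le_iff_exists_mul.1 hcol.ge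
    have hYC : Yᵀ * C = A := by simpa using congrArg transpose hY
    have hA : B * (L * A * R) * C = A := by
      calc B * (L * A * R) * C = B * ((L * B) * X) * R * C := by
            rw [← hX]; simp only [Matrix.mul_assoc]
        _ = Yᵀ * (C * R) * C := by
            rw [hL, Matrix.one_mul, hX, ← hYC]; simp only [Matrix.mul_assoc]
        _ = A := by rw [hR, Matrix.mul_one, hYC]
    refine ⟨L * A * R, isUnit_iff_exists_inv.2 ⟨C * Z, ?_⟩, hA⟩
    calc L * A * R * (C * Z) = (L * B) * (L * A * R) * (C * Z) := by rw [hL, Matrix.one_mul]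
      _ = L * (B * (L * A * R) * C * Z) := by simp only [Matrix.mul_assoc]
      _ = 1 := by rw [hA, hZ, hL]
end

section
/- Let n ≥ 1 and let G be a simple graph on the vertex set Fin n which is not complete. Call a vertex dominating if its degree equals n−1. Then the following are equivalent: (i) for all vertices u, v, w, each with degree ≠ n−1, with u ≠ w, if u is adjacent to v and v is adjacent to w then u is adjacent to w (i.e., the induced subgraph on the non-dominating vertices is a disjoint union of cliques); (ii) for every vertex v with degree d ≠ n−1, the closed neighborhood of v, namely {v} together with the neighbors of v (a set of cardinality d + 1), is a maximal clique of G. -/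
/-- A vertex of degree one less than the number of vertices is universal. -/
theorem SimpleGraph.isUniversal_of_degree_eq_card_sub_one {V : Type*} [Fintype V]
    (G : SimpleGraph V) {v : V} [Fintype (G.neighborSet v)]
    (hv : G.degree v = Fintype.card V - 1) : G.IsUniversal v := by
  classical
  intro w hvw
  have hsub : G.neighborFinset v ⊆ Finset.univ.erase v := fun x hx =>
    Finset.mem_erase.2 ⟨((G.mem_neighborFinset v x).1 hx).ne', Finset.mem_univ x⟩
  have heq : G.neighborFinset v = Finset.univ.erase v :=
    Finset.eq_of_subset_of_card_le hsub (by
      rw [G.card_neighborFinset_eq_degree, hv, Finset.card_erase_of_mem (Finset.mem_univ v),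
        Finset.card_univ])
  rw [← G.mem_neighborFinset, heq]
  exact Finset.mem_erase.2 ⟨hvw.symm, Finset.mem_univ w⟩

/-- A closed neighborhood has one element more than the degree. -/
theorem SimpleGraph.ncard_insert_neighborSet {V : Type*} (G : SimpleGraph V) (v : V)
    [Fintype (G.neighborSet v)] :
    (insert v (G.neighborSet v)).ncard = G.degree v + 1 := by
  rw [Set.ncard_insert_of_notMem (by simp) (Set.toFinite _), Set.ncard_eq_toFinset_card',
    ← G.card_neighborFinset_eq_degree]
  rfl

/-- Proposition 3.2: for a non-complete graph `G` on `n` vertices, adjacency is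
transitive among distinct non-dominating vertices iff every vertex of degree
`d ≠ n - 1` has closed neighborhood a maximal clique (of cardinality `d + 1`). -/
theorem stmt_3 (n : ℕ) (hn : 1 ≤ n) (G : SimpleGraph (Fin n)) [DecidableRel G.Adj]
    (hG : G ≠ ⊤) :
    (∀ u v w : Fin n, G.degree u ≠ n - 1 → G.degree v ≠ n - 1 → G.degree w ≠ n - 1 →
        u ≠ w → G.Adj u v → G.Adj v w → G.Adj u w) ↔
      (∀ v : Fin n, G.degree v ≠ n - 1 →
        (insert v (G.neighborSet v)).ncard = G.degree v + 1 ∧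
        G.IsClique (insert v (G.neighborSet v)) ∧
        ∀ s : Set (Fin n), G.IsClique s → insert v (G.neighborSet v) ⊆ s →
          s = insert v (G.neighborSet v)) := by
  constructor
  · intro h v hv
    have univ_of_degree {x : Fin n} (hx : G.degree x = n - 1) : G.IsUniversal x :=
      G.isUniversal_of_degree_eq_card_sub_one (by rw [hx, Fintype.card_fin])
    refine ⟨G.ncard_insert_neighborSet v, ?_, fun s hs hsub => ?_⟩
    · rw [SimpleGraph.isClique_insert]
      refine ⟨fun x hx y hy hxy => ?_, fun b hb _ => hb⟩
      by_cases hdx : G.degree x = n - 1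
      · exact univ_of_degree hdx hxy
      by_cases hdy : G.degree y = n - 1
      · exact (univ_of_degree hdy hxy.symm).symm
      exact h x v y hdx hv hdy hxy (SimpleGraph.Adj.symm hx) hy
    · refine Set.Subset.antisymm (fun x hx => ?_) hsub
      by_cases hxv : x = v
      · exact Or.inl hxv
      · exact Or.inr (hs (hsub (Set.mem_insert v _)) hx (Ne.symm hxv))
  · intro h u v w _ hv _ huw huv hvw
    exact (h v hv).2.1 (Set.mem_insert_of_mem v huv.symm) (Set.mem_insert_of_mem v hvw) huw
end

section
/- Let K be a field, n ≥ 3, and let A be an n×(n−2) matrix over K with rank A = n−2. Define the simple graph G = Graph(A) on vertex set Fin n in which distinct vertices i and j are adjacent if and only if for every injection f : Fin (n−2) ↪ Fin n with range equal to the complement of {i, j}, det (A.submatrix f id) = 0. Then G is permissible; that is: (a) G is not complete (there exist distinct vertices i, j that are not adjacent), and (b) for all vertices u, v, w of G, each with degree ≠ n−1, with u ≠ w, if u is adjacent to v and v is adjacent to w then u is adjacent to w. -/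
/-- The adjacency relation of `Graph(A)` for an `n × (n-2)` matrix `A`:
distinct vertices `i` and `j` are joined exactly when the `(n-2)`-minor of `A`
on the rows complementary to `{i, j}` vanishes. -/
def graphAdj {K : Type*} [Field K] {n : ℕ} (A : Matrix (Fin n) (Fin (n - 2)) K)
    (i j : Fin n) : Prop :=
  i ≠ j ∧ ∀ f : Fin (n - 2) ↪ Fin n,
    Set.range f = ({i, j} : Set (Fin n))ᶜ → (A.submatrix f id).det = 0

/-- The degree of a vertex in `Graph(A)`. -/
noncomputable def graphDeg {K : Type*} [Field K] {n : ℕ}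
    (A : Matrix (Fin n) (Fin (n - 2)) K) (v : Fin n) : ℕ :=
  {u : Fin n | graphAdj A v u}.ncard

open Matrix

/-- The space of linear relations between the rows of `A`. -/
def rowRelations {K : Type*} [Field K] {n m : ℕ} (A : Matrix (Fin n) (Fin m) K) :
    Submodule K (Fin n → K) :=
  LinearMap.ker A.vecMulLinear

lemma mem_rowRelations {K : Type*} [Field K] {n m : ℕ} {A : Matrix (Fin n) (Fin m) K}
    {y : Fin n → K} : y ∈ rowRelations A ↔ y ᵥ* A = 0 := by
  simp [rowRelations]

lemma finrank_rowRelations_add_rank {K : Type*} [Field K] {n m : ℕ}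
    (A : Matrix (Fin n) (Fin m) K) :
    Module.finrank K (rowRelations A) + A.rank = n := by
  have h := LinearMap.finrank_range_add_finrank_ker A.vecMulLinear
  have hr : Module.finrank K (LinearMap.range A.vecMulLinear) = A.rank := by
    rw [← rank_transpose, Matrix.rank, mulVecLin_transpose]
  rw [hr, Module.finrank_fin_fun] at h
  rw [rowRelations]
  omega

lemma vecMul_submatrix_embedding {K ι : Type*} [Field K] [Fintype ι] {n m : ℕ}
    (A : Matrix (Fin n) (Fin m) K) (f : ι ↪ Fin n) (y : Fin n → K)
    (hy : ∀ i ∉ Set.range f, y i = 0) :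
    (y ∘ f) ᵥ* A.submatrix f id = y ᵥ* A := by
  ext k
  simp only [vecMul, dotProduct]
  exact Fintype.sum_of_injective f f.injective _ _ (fun i hi => by simp [hy i hi]) fun _ => rfl

lemma det_submatrix_eq_zero_iff {K : Type*} [Field K] {n m : ℕ}
    (A : Matrix (Fin n) (Fin m) K) (f : Fin m ↪ Fin n) :
    (A.submatrix f id).det = 0 ↔
      ∃ y ∈ rowRelations A, y ≠ 0 ∧ ∀ i ∉ Set.range f, y i = 0 := by
  rw [← exists_vecMul_eq_zero_iff]
  constructor
  · rintro ⟨v, hv, hvA⟩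
    have hext : ∀ i ∉ Set.range f, Function.extend f v 0 i = 0 := fun i hi =>
      Function.extend_apply' _ _ _ hi
    have hcomp : Function.extend f v 0 ∘ f = v := funext fun k => f.injective.extend_apply v 0 k
    refine ⟨Function.extend f v 0, ?_, ?_, hext⟩
    · rw [mem_rowRelations, ← vecMul_submatrix_embedding A f _ hext, hcomp, hvA]
    · intro h
      rw [h] at hcomp
      exact hv hcomp.symm
  · rintro ⟨y, hyA, hy, hyf⟩
    refine ⟨y ∘ f, fun h => hy ?_, ?_⟩
    · ext i
      by_cases hi : i ∈ Set.range f
      · obtain ⟨k, rfl⟩ := hi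
        exact congrFun h k
      · exact hyf i hi
    · rw [vecMul_submatrix_embedding A f y hyf]
      exact mem_rowRelations.1 hyA

lemma exists_embedding_range_eq_compl_pair {n : ℕ} {i j : Fin n} (hij : i ≠ j) :
    ∃ f : Fin (n - 2) ↪ Fin n, Set.range f = ({i, j} : Set (Fin n))ᶜ := by
  have hcard : (({i, j} : Finset (Fin n))ᶜ).card = n - 2 := by
    rw [Finset.card_compl, Finset.card_pair hij, Fintype.card_fin]
  refine ⟨((({i, j} : Finset (Fin n))ᶜ).orderEmbOfFin hcard).toEmbedding, ?_⟩
  change Set.range ((({i, j} : Finset (Fin n))ᶜ).orderEmbOfFin hcard) = _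
  rw [Finset.range_orderEmbOfFin, Finset.coe_compl, Finset.coe_pair]

lemma graphAdj_iff {K : Type*} [Field K] {n : ℕ} {A : Matrix (Fin n) (Fin (n - 2)) K}
    {i j : Fin n} :
    graphAdj A i j ↔ i ≠ j ∧ ∃ y ∈ rowRelations A, y ≠ 0 ∧ y i = 0 ∧ y j = 0 := by
  refine and_congr_right fun hij => ?_
  have key : ∀ f : Fin (n - 2) ↪ Fin n, Set.range f = ({i, j} : Set (Fin n))ᶜ →
      ((A.submatrix f id).det = 0 ↔ ∃ y ∈ rowRelations A, y ≠ 0 ∧ y i = 0 ∧ y j = 0) := by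
    intro f hf
    rw [det_submatrix_eq_zero_iff, hf]
    simp [← or_iff_not_imp_left, or_imp, forall_and]
  obtain ⟨f, hf⟩ := exists_embedding_range_eq_compl_pair hij
  exact ⟨fun h => (key f hf).1 (h f hf), fun h f hf => (key f hf).2 h⟩

lemma exists_mem_ne_zero_apply_eq_zero {K ι : Type*} [Field K] {L : Submodule K (ι → K)}
    (hL : Module.finrank K L = 2) (u : ι) : ∃ y ∈ L, y ≠ 0 ∧ y u = 0 := by
  have : FiniteDimensional K L := Module.finite_of_finrank_pos (by omega)
  obtain ⟨y, hy, hy0⟩ := Submodule.exists_mem_ne_zero_of_ne_bot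
    (LinearMap.ker_ne_bot_of_finrank_lt (f := LinearMap.proj u ∘ₗ L.subtype)
      (by rw [hL, Module.finrank_self]; norm_num))
  exact ⟨y, y.2, by simpa using hy0, by simpa using hy⟩

/-- In a plane of functions not all vanishing at `v`, those vanishing at `v` form a line. -/
lemma exists_smul_eq_of_apply_eq_zero {K ι : Type*} [Field K] {L : Submodule K (ι → K)}
    (hL : Module.finrank K L = 2) {v : ι} {x y z : ι → K} (hx : x ∈ L) (hxv : x v ≠ 0)
    (hy : y ∈ L) (hy0 : y ≠ 0) (hyv : y v = 0) (hz : z ∈ L) (hzv : z v = 0) :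
    ∃ c : K, c • y = z := by
  have : FiniteDimensional K L := Module.finite_of_finrank_pos (by omega)
  let φ : L →ₗ[K] K := LinearMap.proj v ∘ₗ L.subtype
  have hφ : φ ≠ 0 := fun h => hxv (by simpa [φ] using LinearMap.congr_fun h ⟨x, hx⟩)
  have hrange : Module.finrank K (LinearMap.range φ) = 1 := by
    rw [LinearMap.range_eq_top.2 (LinearMap.surjective hφ), finrank_top, Module.finrank_self]
  have hker : Module.finrank K (LinearMap.ker φ) = 1 := by
    have := φ.finrank_range_add_finrank_ker
    omega
  obtain ⟨c, hc⟩ := exists_smul_eq_of_finrank_eq_one hker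
    (x := (⟨⟨y, hy⟩, hyv⟩ : LinearMap.ker φ)) 
    (fun h => hy0 (congrArg (fun a : LinearMap.ker φ => (a : ι → K)) h))
    (⟨⟨z, hz⟩, hzv⟩ : LinearMap.ker φ)
  exact ⟨c, congrArg (fun a : LinearMap.ker φ => (a : ι → K)) hc⟩

lemma graphDeg_eq_of_forall_adj {K : Type*} [Field K] {n : ℕ}
    {A : Matrix (Fin n) (Fin (n - 2)) K} {v : Fin n} (h : ∀ u, v ≠ u → graphAdj A v u) :
    graphDeg A v = n - 1 := by
  have hset : {u : Fin n | graphAdj A v u} = {v}ᶜ := by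
    ext u
    exact ⟨fun hu => hu.1.symm, fun hu => h u (Ne.symm hu)⟩
  rw [graphDeg, hset, Set.ncard_compl, Set.ncard_singleton, Nat.card_fin]

/-- The graph `Graph(A)` associated to a rank `n-2` matrix `A` is permissible:
it is not complete, and adjacency is transitive among distinct non-dominating
vertices. -/
theorem stmt_4 (K : Type*) [Field K] (n : ℕ) (hn : 3 ≤ n)
    (A : Matrix (Fin n) (Fin (n - 2)) K) (hA : A.rank = n - 2) :
    (∃ i j : Fin n, i ≠ j ∧ ¬ graphAdj A i j) ∧
    (∀ u v w : Fin n, graphDeg A u ≠ n - 1 → graphDeg A v ≠ n - 1 →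
      graphDeg A w ≠ n - 1 → u ≠ w → graphAdj A u v → graphAdj A v w →
      graphAdj A u w) := by
  have hL : Module.finrank K (rowRelations A) = 2 := by
    have := finrank_rowRelations_add_rank A
    omega
  have hne : ∀ y : Fin n → K, y ≠ 0 → ∃ i, y i ≠ 0 := fun y hy => Function.ne_iff.1 hy
  refine ⟨?_, fun u v w _ hv _ huw huv hvw => ?_⟩
  · obtain ⟨x, hx, hx0, -⟩ := exists_mem_ne_zero_apply_eq_zero hL ⟨0, by omega⟩
    obtain ⟨i, hi⟩ := hne x hx0
    obtain ⟨z, hz, hz0, hzi⟩ := exists_mem_ne_zero_apply_eq_zero hL i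
    obtain ⟨j, hj⟩ := hne z hz0
    refine ⟨i, j, fun h => hj (h ▸ hzi), fun hadj => ?_⟩
    obtain ⟨-, y, hy, hy0, hyi, hyj⟩ := graphAdj_iff.1 hadj
    obtain ⟨c, rfl⟩ := exists_smul_eq_of_apply_eq_zero hL hx hi hy hy0 hyi hz hzi
    exact hj (by simp [hyj])
  · obtain ⟨-, y, hy, hy0, hyu, hyv⟩ := graphAdj_iff.1 huv
    obtain ⟨-, z, hz, hz0, hzv, hzw⟩ := graphAdj_iff.1 hvw
    obtain ⟨x, hx, hxv⟩ : ∃ x ∈ rowRelations A, x v ≠ 0 := by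
      by_contra! hvan
      refine hv (graphDeg_eq_of_forall_adj fun t hvt => graphAdj_iff.2 ⟨hvt, ?_⟩)
      obtain ⟨t', ht', ht0, htt⟩ := exists_mem_ne_zero_apply_eq_zero hL t
      exact ⟨t', ht', ht0, hvan t' ht', htt⟩
    obtain ⟨c, rfl⟩ := exists_smul_eq_of_apply_eq_zero hL hx hxv hy hy0 hyv hz hzv
    exact graphAdj_iff.2 ⟨huw, c • y, hz, hz0, by simp [hyu], hzw⟩
end

section
/- Let K be a field and R = MvPolynomial (Fin 2 × Fin 3) K, the polynomial ring in the entries x_{kj} = X (k, j) of a generic 2×3 matrix (rows indexed by k ∈ Fin 2, columns by j ∈ Fin 3). For columns j ≠ j', write m_{j,j'} = x_{0j} x_{1j'} − x_{0j'} x_{1j} for the corresponding 2-minor. Then the ideal generated by the two overlapping minors m_{0,1} and m_{1,2} decomposes as: Ideal.span {m_{0,1}, m_{1,2}} = Ideal.span {m_{0,1}, m_{0,2}, m_{1,2}} ⊓ Ideal.span {x_{01}, x_{11}}. -/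
open MvPolynomial

/-- A polynomial that vanishes when the variables in `s` are set to zero lies in the ideal
generated by these variables. -/
theorem mem_span_X_image_of_aeval_eq_zero {σ R : Type*} [CommRing R] (s : Set σ)
    [DecidablePred (· ∈ s)] {p : MvPolynomial σ R}
    (hp : aeval (fun i ↦ if i ∈ s then 0 else (X i : MvPolynomial σ R)) p = 0) :
    p ∈ Ideal.span ((X : σ → MvPolynomial σ R) '' s) := by
  set I := Ideal.span ((X : σ → MvPolynomial σ R) '' s)
  have h : (Ideal.Quotient.mkₐ R I).comp
      (aeval fun i ↦ if i ∈ s then 0 else (X i : MvPolynomial σ R)) =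
      Ideal.Quotient.mkₐ R I := by
    ext i
    by_cases hi : i ∈ s
    · have hX : X i ∈ I := Ideal.subset_span ⟨i, hi, rfl⟩
      simp [hi, Ideal.Quotient.eq_zero_iff_mem.mpr hX]
    · simp [hi]
  have hq := DFunLike.congr_fun h p
  rw [AlgHom.comp_apply, hp, map_zero] at hq
  exact Ideal.Quotient.eq_zero_iff_mem.mp hq.symm

/-- The ideal of two overlapping 2-minors of a generic 2×3 matrix is the
intersection of the ideal of all three 2-minors and the ideal of the two
entries of the overlapping column. -/
theorem stmt_6 (K : Type*) [Field K] :
    (Ideal.span {(X (0, 0) * X (1, 1) - X (0, 1) * X (1, 0) :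
        MvPolynomial (Fin 2 × Fin 3) K),
      X (0, 1) * X (1, 2) - X (0, 2) * X (1, 1)}) =
    (Ideal.span {(X (0, 0) * X (1, 1) - X (0, 1) * X (1, 0) :
        MvPolynomial (Fin 2 × Fin 3) K),
      X (0, 0) * X (1, 2) - X (0, 2) * X (1, 0),
      X (0, 1) * X (1, 2) - X (0, 2) * X (1, 1)}) ⊓
    (Ideal.span {(X (0, 1) : MvPolynomial (Fin 2 × Fin 3) K), X (1, 1)}) := by
  apply le_antisymm
  · refine le_inf (Ideal.span_mono (by grind)) (Ideal.span_le.mpr ?_)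
    rintro _ (rfl | rfl) <;> refine Ideal.mem_span_pair.mpr ?_
    · exact ⟨-X (1, 0), X (0, 0), by ring⟩
    · exact ⟨X (1, 2), -X (0, 2), by ring⟩
  · rintro f ⟨hf, hfP⟩
    obtain ⟨a, b, c, rfl⟩ := Submodule.mem_span_triple.mp hf
    obtain ⟨u, v, huv⟩ := Ideal.mem_span_pair.mp hfP
    let s : Set (Fin 2 × Fin 3) := {(0, 1), (1, 1)}
    have hb : b ∈ Ideal.span ((X : _ → MvPolynomial (Fin 2 × Fin 3) K) '' s) := by
      classical
      apply mem_span_X_image_of_aeval_eq_zero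
      have hne : (X (0, 0) * X (1, 2) - X (0, 2) * X (1, 0) :
          MvPolynomial (Fin 2 × Fin 3) K) ≠ 0 := fun h ↦ by
        simpa using congrArg
          (eval fun i ↦ if i = (0, 0) ∨ i = (1, 2) then (1 : K) else 0) h
      refine (mul_eq_zero.mp ?_).resolve_right hne
      simpa [s] using (congrArg
        (aeval fun i ↦ if i ∈ s then 0 else (X i : MvPolynomial (Fin 2 × Fin 3) K)) huv).symm
    rw [Set.image_pair] at hb
    obtain ⟨p, q, rfl⟩ := Ideal.mem_span_pair.mp hb
    refine Ideal.mem_span_pair.mpr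
      ⟨a + p * X (0, 2) + q * X (1, 2), c + p * X (0, 0) + q * X (1, 0), ?_⟩
    simp only [smul_eq_mul]
    ring
end

section
/- Let K be a field, a ≥ 1 an integer, and R = MvPolynomial (Fin 2 × Fin a) K, the polynomial ring in the entries x_{kj} = X (k, j) of a generic 2×a matrix. Let I be the ideal of R generated by all 2×2 minors x_{0j} x_{1j'} − x_{0j'} x_{1j} for j ≠ j' in Fin a. Then I is a prime ideal and its height is a − 1. -/
open MvPolynomial

/-- The height of an ideal `I`: the infimum of the heights of the prime ideals
containing `I` (the height of a prime being its height in the prime spectrum). -/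
noncomputable def idealHeight {R : Type*} [CommRing R] (I : Ideal R) : ℕ∞ :=
  ⨅ p ∈ {p : PrimeSpectrum R | I ≤ p.asIdeal}, Order.height p

section Minors

variable {ι κ : Type*} (K : Type*) [CommRing K]

/-- The ideal generated by the `2 × 2` minors of a generic `ι × κ` matrix. -/
noncomputable def minorsIdeal (ι κ : Type*) : Ideal (MvPolynomial (ι × κ) K) :=
  Ideal.span {p | ∃ i i' j j', p = X (i, j) * X (i', j') - X (i, j') * X (i', j)}

/-- The substitution sending the columns of a generic matrix indexed by `S` to the columns of a
generic matrix of rank one, and the other columns to themselves. -/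
noncomputable def rankOneOn (ι : Type*) (S : Set κ) :
    MvPolynomial (ι × κ) K →ₐ[K] MvPolynomial (ι ⊕ κ ⊕ ι × κ) K :=
  open scoped Classical in
  aeval fun p ↦ if p.2 ∈ S then X (.inl p.1) * X (.inr (.inl p.2)) else X (.inr (.inr p))

variable {K}

lemma rankOneOn_X_of_mem {S : Set κ} (i : ι) {j : κ} (hj : j ∈ S) :
    rankOneOn K ι S (X (i, j)) = X (.inl i) * X (.inr (.inl j)) := by
  simp [rankOneOn, hj]

lemma rankOneOn_X_of_notMem {S : Set κ} (i : ι) {j : κ} (hj : j ∉ S) :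
    rankOneOn K ι S (X (i, j)) = X (.inr (.inr (i, j))) := by
  simp [rankOneOn, hj]

lemma prod_map_X_sub_mem_minorsIdeal (s t : Multiset (ι × κ))
    (h₁ : s.map Prod.fst = t.map Prod.fst) (h₂ : s.map Prod.snd = t.map Prod.snd) :
    (s.map X).prod - (t.map X).prod ∈ minorsIdeal K ι κ := by
  classical
  induction s using Multiset.induction generalizing t with
  | empty =>
    obtain rfl : t = 0 := by simpa using h₁.symm
    simp
  | cons p s ih =>
    obtain ⟨i, j⟩ := p
    by_cases hp : (i, j) ∈ t
    · obtain ⟨t, rfl⟩ := Multiset.exists_cons_of_mem hp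
      simp only [Multiset.map_cons, Multiset.cons_inj_right] at h₁ h₂
      simpa [mul_sub] using Ideal.mul_mem_left _ (X (i, j)) (ih t h₁ h₂)
    obtain ⟨⟨i₁, j'⟩, hq, rfl : i₁ = i⟩ : ∃ q ∈ t, q.1 = i :=
      Multiset.mem_map.1 (h₁ ▸ by simp)
    obtain ⟨⟨i', j₁⟩, hr, rfl : j₁ = j⟩ : ∃ q ∈ t, q.2 = j :=
      Multiset.mem_map.1 (h₂ ▸ by simp)
    obtain ⟨t, rfl⟩ := Multiset.exists_cons_of_mem hq
    have hr' : (i', j₁) ∈ t := by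
      rcases Multiset.mem_cons.1 hr with h | h
      · exact absurd (by simp_all) hp
      · exact h
    obtain ⟨t, rfl⟩ := Multiset.exists_cons_of_mem hr'
    have key := ih ((i', j') ::ₘ t) (by simpa using h₁) (by
      simp only [Multiset.map_cons] at h₂ ⊢
      rwa [Multiset.cons_swap, Multiset.cons_inj_right] at h₂)
    have hminor : (X (i₁, j₁) * X (i', j') - X (i₁, j') * X (i', j₁) :
        MvPolynomial (ι × κ) K) ∈ minorsIdeal K ι κ :=
      Ideal.subset_span ⟨i₁, i', j₁, j', rfl⟩
    convert add_mem (Ideal.mul_mem_left _ (X (i₁, j₁)) key)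
      (Ideal.mul_mem_left _ (t.map X).prod hminor) using 1
    simp only [Multiset.map_cons, Multiset.prod_cons]
    ring

lemma prod_map_X_toMultiset {σ : Type*} (u : σ →₀ ℕ) :
    ((Finsupp.toMultiset u).map X).prod = (monomial u 1 : MvPolynomial σ K) := by
  classical
  induction u using Finsupp.induction_linear with
  | zero => simp
  | add u v hu hv => simp [hu, hv, monomial_mul]
  | single a n => simp [Multiset.map_nsmul, Multiset.prod_nsmul, X_pow_eq_monomial]

lemma rankOneOn_univ_monomial (u : ι × κ →₀ ℕ) :
    rankOneOn K ι Set.univ (monomial u 1) =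
      monomial ((u.mapDomain Prod.fst).mapDomain Sum.inl +
        ((u.mapDomain Prod.snd).mapDomain Sum.inl).mapDomain Sum.inr) 1 := by
  rw [← one_mul (1 : K), ← monomial_mul, one_mul, ← prod_map_X_toMultiset,
    ← prod_map_X_toMultiset, ← prod_map_X_toMultiset]
  simp only [← Finsupp.toMultiset_map, map_multiset_prod, Multiset.map_map, ← Multiset.prod_map_mul]
  congr 1
  refine Multiset.map_congr rfl fun p _ ↦ ?_
  simp [rankOneOn]

theorem minorsIdeal_eq_ker :
    minorsIdeal K ι κ = RingHom.ker (rankOneOn K ι (Set.univ : Set κ)) := by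
  refine le_antisymm (Ideal.span_le.2 ?_) fun f hf ↦ ?_
  · rintro _ ⟨i, i', j, j', rfl⟩
    simp only [SetLike.mem_coe, RingHom.mem_ker, map_sub, map_mul,
      rankOneOn_X_of_mem _ (Set.mem_univ _)]
    ring
  let M : (ι × κ →₀ ℕ) → (ι ⊕ κ ⊕ ι × κ →₀ ℕ) := fun u ↦
    (u.mapDomain Prod.fst).mapDomain Sum.inl +
      ((u.mapDomain Prod.snd).mapDomain Sum.inl).mapDomain Sum.inr
  have hM {u v} (h : M u = M v) :
      (monomial u 1 - monomial v 1 : MvPolynomial (ι × κ) K) ∈ minorsIdeal K ι κ := by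
    rw [← prod_map_X_toMultiset, ← prod_map_X_toMultiset]
    refine prod_map_X_sub_mem_minorsIdeal _ _ ?_ ?_
    · rw [Finsupp.toMultiset_map, Finsupp.toMultiset_map]
      congr 1
      ext i
      simpa [M, Finsupp.mapDomain_apply Sum.inl_injective, Finsupp.mapDomain_of_notMem_range]
        using DFunLike.congr_fun h (.inl i)
    · rw [Finsupp.toMultiset_map, Finsupp.toMultiset_map]
      congr 1
      ext j
      simpa [M, Finsupp.mapDomain_apply Sum.inl_injective,
        Finsupp.mapDomain_apply Sum.inr_injective, Finsupp.mapDomain_of_notMem_range]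
        using DFunLike.congr_fun h (.inr (.inl j))
  let ψ : MvPolynomial (ι ⊕ κ ⊕ ι × κ) K →ₗ[K] MvPolynomial (ι × κ) K ⧸ minorsIdeal K ι κ :=
    (basisMonomials _ K).constr K fun w ↦
      Ideal.Quotient.mk _ (monomial (Function.invFun M w) 1)
  have hψ : ψ ∘ₗ (rankOneOn K ι Set.univ).toLinearMap =
      (Ideal.Quotient.mkₐ K (minorsIdeal K ι κ)).toLinearMap := by
    refine (basisMonomials _ K).ext fun u ↦ ?_
    have : ψ (monomial (M u) 1) = Ideal.Quotient.mk _ (monomial (Function.invFun M (M u)) 1) := by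
      simpa using (basisMonomials (ι ⊕ κ ⊕ ι × κ) K).constr_basis K (fun w ↦
        Ideal.Quotient.mk (minorsIdeal K ι κ) (monomial (Function.invFun M w) 1)) (M u)
    simp only [coe_basisMonomials, LinearMap.comp_apply, AlgHom.toLinearMap_apply,
      rankOneOn_univ_monomial]
    exact this.trans (Ideal.Quotient.eq.2 (hM (Function.invFun_eq ⟨u, rfl⟩)))
  rw [← Ideal.Quotient.eq_zero_iff_mem]
  have h := DFunLike.congr_fun hψ f
  rw [LinearMap.comp_apply, AlgHom.toLinearMap_apply, (RingHom.mem_ker).1 hf, map_zero] at h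
  exact h.symm

lemma ker_rankOneOn_mono {S T : Set κ} (h : S ⊆ T) :
    RingHom.ker (rankOneOn K ι S) ≤ RingHom.ker (rankOneOn K ι T) := by
  classical
  let ψ : MvPolynomial (ι ⊕ κ ⊕ ι × κ) K →ₐ[K] MvPolynomial (ι ⊕ κ ⊕ ι × κ) K :=
    aeval (Sum.elim (fun i ↦ X (.inl i)) (Sum.elim (fun j ↦ X (.inr (.inl j)))
      fun p ↦ rankOneOn K ι T (X p)))
  have hψ : ψ.comp (rankOneOn K ι S) = rankOneOn K ι T := by
    ext1 ⟨i, j⟩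
    by_cases hj : j ∈ S
    · simp [ψ, rankOneOn_X_of_mem i hj, rankOneOn_X_of_mem i (h hj)]
    · simp [ψ, rankOneOn_X_of_notMem i hj]
  intro f hf
  rw [RingHom.mem_ker] at hf ⊢
  rw [← hψ, AlgHom.comp_apply, hf, map_zero]

lemma ker_rankOneOn_strictMono [Nontrivial K] [Nontrivial ι] {S T : Set κ} (hS : S.Nonempty)
    (h : S ⊂ T) : RingHom.ker (rankOneOn K ι S) < RingHom.ker (rankOneOn K ι T) := by
  classical
  obtain ⟨hST, j, hjT, hjS⟩ := Set.ssubset_iff_exists.1 h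
  obtain ⟨l, hl⟩ := hS
  obtain ⟨i, i', hi⟩ := exists_pair_ne ι
  refine SetLike.lt_iff_le_and_exists.2 ⟨ker_rankOneOn_mono hST,
    X (i, l) * X (i', j) - X (i, j) * X (i', l), ?_, fun hmem ↦ ?_⟩
  · simp only [RingHom.mem_ker, map_sub, map_mul, rankOneOn_X_of_mem _ hjT,
      rankOneOn_X_of_mem _ (hST hl)]
    ring
  · simp only [RingHom.mem_ker, map_sub, map_mul, rankOneOn_X_of_notMem _ hjS,
      rankOneOn_X_of_mem _ hl] at hmem
    simpa [hi.symm] using congrArg (aeval (Sum.elim (fun _ ↦ (1 : K)) (Sum.elim (fun _ ↦ 1)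
      fun p ↦ if p.1 = i then 0 else 1))) hmem

instance isPrime_ker_rankOneOn [IsDomain K] (S : Set κ) :
    (RingHom.ker (rankOneOn K ι S)).IsPrime :=
  RingHom.ker_isPrime _

instance isPrime_minorsIdeal [IsDomain K] : (minorsIdeal K ι κ).IsPrime :=
  minorsIdeal_eq_ker (K := K) (ι := ι) (κ := κ) ▸ isPrime_ker_rankOneOn Set.univ

lemma X_notMem_minorsIdeal [IsDomain K] (p : ι × κ) : X p ∉ minorsIdeal K ι κ := by
  rw [minorsIdeal_eq_ker, RingHom.mem_ker, ← Prod.mk.eta (p := p),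
    rankOneOn_X_of_mem _ (Set.mem_univ _)]
  simp [X_ne_zero]

lemma le_height_minorsIdeal [IsDomain K] [Nontrivial ι] (n : ℕ) :
    n ≤ (minorsIdeal K ι (Fin (n + 1))).height := by
  let s : LTSeries (PrimeSpectrum (MvPolynomial (ι × Fin (n + 1)) K)) :=
    { length := n
      toFun := fun b ↦ ⟨RingHom.ker (rankOneOn K ι (Set.Iic b)), isPrime_ker_rankOneOn _⟩
      step := fun b ↦ ker_rankOneOn_strictMono Set.nonempty_Iic
        (Set.Iic_ssubset_Iic.2 b.castSucc_lt_succ) }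
  have hs : s.last = ⟨minorsIdeal K ι (Fin (n + 1)), inferInstance⟩ := by
    ext1
    exact (minorsIdeal_eq_ker.trans (by rw [← Set.Iic_top]; rfl)).symm
  have := Order.length_le_height_last (p := s)
  rwa [hs, ← PrimeSpectrum.height_eq_orderHeight] at this

/-- Minors of a two-rowed matrix involving a fixed column `l` cut out the ideal of all minors
away from the vanishing locus of an entry of that column. -/
lemma minorsIdeal_le_of_isPrime {l : κ} {Q : Ideal (MvPolynomial (Fin 2 × κ) K)} [Q.IsPrime]
    (hQ : ∀ j ≠ l, X (0, l) * X (1, j) - X (0, j) * X (1, l) ∈ Q) (hl : X (0, l) ∉ Q) :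
    minorsIdeal K (Fin 2) κ ≤ Q := by
  have hQ' (j) : X (0, l) * X (1, j) - X (0, j) * X (1, l) ∈ Q := by
    obtain rfl | hj := eq_or_ne j l
    · simp
    · exact hQ j hj
  have h (j j') : X (0, j) * X (1, j') - X (0, j') * X (1, j) ∈ Q := by
    refine (Ideal.IsPrime.mem_or_mem ‹_› (?_ : X (0, l) * _ ∈ Q)).resolve_left hl
    convert sub_mem (Q.mul_mem_left (X (0, j)) (hQ' j'))
      (Q.mul_mem_left (X (0, j')) (hQ' j)) using 1
    ring
  refine Ideal.span_le.2 ?_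
  rintro _ ⟨i, i', j, j', rfl⟩
  fin_cases i <;> fin_cases i'
  · simp [mul_comm]
  · exact h j j'
  · convert h j' j using 1
    simp [mul_comm]
  · simp [mul_comm]

lemma height_minorsIdeal_le [IsDomain K] [IsNoetherianRing K] (n : ℕ) :
    (minorsIdeal K (Fin 2) (Fin (n + 1))).height ≤ n := by
  classical
  let g : Fin n → MvPolynomial (Fin 2 × Fin (n + 1)) K := fun j ↦
    X (0, 0) * X (1, j.succ) - X (0, j.succ) * X (1, 0)
  have hmin : minorsIdeal K (Fin 2) (Fin (n + 1)) ∈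
      (Ideal.span (Finset.univ.image g : Set (MvPolynomial _ K))).minimalPrimes := by
    refine ⟨⟨inferInstance, Ideal.span_le.2 ?_⟩, fun Q ⟨hQ, hgQ⟩ hle ↦ ?_⟩
    · intro p hp
      obtain ⟨j, rfl⟩ : ∃ j, g j = p := by simpa using hp
      exact Ideal.subset_span ⟨0, 1, 0, j.succ, rfl⟩
    · refine minorsIdeal_le_of_isPrime (l := 0) (fun j hj ↦ ?_)
        fun h ↦ X_notMem_minorsIdeal _ (hle h)
      obtain ⟨j, rfl⟩ := Fin.exists_succ_eq.2 hj
      exact hgQ (Ideal.subset_span (by simp [g]))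
  refine (Ideal.height_le_card_of_mem_minimalPrimes_span_finset hmin).trans ?_
  exact_mod_cast Finset.card_image_le.trans (by simp)

end Minors

lemma idealHeight_eq_height {R : Type*} [CommRing R] (I : Ideal R) [hI : I.IsPrime] :
    idealHeight I = I.height := by
  rw [PrimeSpectrum.height_eq_orderHeight ⟨I, hI⟩]
  exact le_antisymm (iInf₂_le (⟨I, hI⟩ : PrimeSpectrum R) le_rfl)
    (le_iInf₂ fun p hp ↦ Order.height_mono (show (⟨I, hI⟩ : PrimeSpectrum R) ≤ p from hp))

lemma span_minors_eq_minorsIdeal (K κ : Type*) [CommRing K] :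
    Ideal.span {p : MvPolynomial (Fin 2 × κ) K | ∃ j j' : κ, j ≠ j' ∧
      p = X (0, j) * X (1, j') - X (0, j') * X (1, j)} = minorsIdeal K (Fin 2) κ := by
  refine le_antisymm (Ideal.span_mono ?_) (Ideal.span_le.2 ?_)
  · rintro _ ⟨j, j', -, rfl⟩
    exact ⟨0, 1, j, j', rfl⟩
  · rintro _ ⟨i, i', j, j', rfl⟩
    obtain rfl | hj := eq_or_ne j j'
    · simp
    fin_cases i <;> fin_cases i'
    · simp [mul_comm]
    · exact Ideal.subset_span ⟨j, j', hj, rfl⟩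
    · refine Ideal.subset_span ⟨j', j, hj.symm, ?_⟩
      simp [mul_comm]
    · simp [mul_comm]

/-- Hochster–Eagon input: the ideal of 2×2 minors of a generic 2×a matrix is a
prime ideal of height `a - 1`. -/
theorem stmt_7 (K : Type*) [Field K] (a : ℕ) (ha : 1 ≤ a) :
    (Ideal.span {p : MvPolynomial (Fin 2 × Fin a) K | ∃ j j' : Fin a, j ≠ j' ∧
        p = X (0, j) * X (1, j') - X (0, j') * X (1, j)}).IsPrime ∧
    idealHeight (Ideal.span {p : MvPolynomial (Fin 2 × Fin a) K | ∃ j j' : Fin a, j ≠ j' ∧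
        p = X (0, j) * X (1, j') - X (0, j') * X (1, j)}) = (a - 1 : ℕ) := by
  obtain ⟨n, rfl⟩ := Nat.exists_eq_add_of_le' ha
  rw [span_minors_eq_minorsIdeal]
  refine ⟨inferInstance, ?_⟩
  rw [idealHeight_eq_height, Nat.add_sub_cancel]
  exact le_antisymm (height_minorsIdeal_le n) (le_height_minorsIdeal n)
end

section
/- Let K be a field, s ≥ 1, and R = MvPolynomial (Fin 2 × Fin s) K, the polynomial ring in the entries x_{kj} = X (k, j) of a generic 2×s matrix. Let T, R₀, R₁, S₁, …, S_c be pairwise disjoint subsets of Fin s, with each Sᵢ nonempty. Let I be the ideal of R generated by: the entries x_{0j} and x_{1j} for all j ∈ T; the entries x_{0j} for j ∈ R₀; the entries x_{1j} for j ∈ R₁; and all 2×2 minors x_{0j} x_{1j'} − x_{0j'} x_{1j} with j ≠ j' lying in a common Sᵢ. Then the height of I equals 2·|T| + |R₀| + |R₁| + Σᵢ (|Sᵢ| − 1). -/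
open MvPolynomial

/-- If modulo the prime `p` each variable `X v`, `v ∈ E`, is a solution of a linear equation
`a v * X v = b v` whose coefficients involve only the variables outside `E`, with `a v ∉ p`, then
some prime of height `#E` below `p` contains all these equations. -/
theorem MvPolynomial.exists_isPrime_le_height_eq_card {σ K : Type*} [Finite σ] [Field K]
    (E : Finset σ) (a b : σ → MvPolynomial σ K)
    (p : Ideal (MvPolynomial σ K)) (hp : p.IsPrime)
    (ha : ∀ v ∈ E, a v ∈ supported K (E : Set σ)ᶜ)
    (hb : ∀ v ∈ E, b v ∈ supported K (E : Set σ)ᶜ)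
    (hap : ∀ v ∈ E, a v ∉ p) (habp : ∀ v ∈ E, a v * X v - b v ∈ p) :
    ∃ P : Ideal (MvPolynomial σ K), P.IsPrime ∧ P ≤ p ∧ P.height = E.card ∧
      (∀ v ∈ E, a v * X v - b v ∈ P) ∧
      (∀ g ∈ supported K (E : Set σ)ᶜ, g ∈ P → g = 0) := by
  classical
  induction E using Finset.induction_on generalizing p with
  | empty =>
    refine ⟨⊥, Ideal.isPrime_bot, bot_le, ?_, by simp, fun g _ hg => by simpa using hg⟩
    simp [Ideal.height_bot]
  | insert w E hw ih =>
    set F := insert w E with hF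
    let A := Localization.AtPrime p
    have hinj : Function.Injective (algebraMap (MvPolynomial σ K) A) :=
      IsLocalization.injective A p.primeCompl_le_nonZeroDivisors
    have : IsDomain A := IsLocalization.isDomain_localization p.primeCompl_le_nonZeroDivisors
    have hu : ∀ v ∈ F, IsUnit (algebraMap (MvPolynomial σ K) A (a v)) := fun v hv =>
      IsLocalization.map_units A (M := p.primeCompl) ⟨a v, hap v hv⟩
    let ι : MvPolynomial σ K →+* A := algebraMap (MvPolynomial σ K) A
    let y : σ → A := fun v => if v ∈ F then ι (b v) * Ring.inverse (ι (a v)) else ι (X v)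
    let φ : MvPolynomial σ K →ₐ[K] A := aeval y
    have hφ : ∀ g ∈ supported K (F : Set σ)ᶜ, φ g = algebraMap _ A g := by
      intro g hg
      have : supported K (F : Set σ)ᶜ ≤
          AlgHom.equalizer φ (IsScalarTower.toAlgHom K (MvPolynomial σ K) A) := by
        rw [supported_eq_adjoin_X, Algebra.adjoin_le_iff]
        rintro _ ⟨v, hv, rfl⟩
        have hv' : v ∉ F := by simpa using hv
        simp [φ, y, ι, hv']
      exact this hg
    have hφF : ∀ v ∈ F, φ (a v * X v - b v) = 0 := by
      intro v hv
      have h1 : φ (X v) = algebraMap _ A (b v) * Ring.inverse (algebraMap _ A (a v)) := by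
        simp [φ, y, ι, hv]
      rw [map_sub, map_mul, hφ _ (ha v hv), hφ _ (hb v hv), h1, mul_left_comm,
        Ring.mul_inverse_cancel _ (hu v hv), mul_one, sub_self]
    let P : Ideal (MvPolynomial σ K) := RingHom.ker φ
    have hPp : P.IsPrime := RingHom.ker_isPrime φ
    have hmin : ∀ q : Ideal (MvPolynomial σ K), q.IsPrime → q ≤ p →
        (∀ v ∈ F, a v * X v - b v ∈ q) → P ≤ q := by
      intro q hq hqp hv g hg
      let L := FractionRing (MvPolynomial σ K ⧸ q)
      let m : MvPolynomial σ K →+* L := (algebraMap (MvPolynomial σ K ⧸ q) L).comp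
        (Ideal.Quotient.mk q)
      have hm : ∀ g, m g = 0 ↔ g ∈ q := by
        intro g
        rw [← Ideal.Quotient.eq_zero_iff_mem]
        exact map_eq_zero_iff _ (IsFractionRing.injective (MvPolynomial σ K ⧸ q) L)
      have hmu : ∀ g : p.primeCompl, IsUnit (m g) := fun g =>
        isUnit_iff_ne_zero.2 fun h => g.2 (hqp ((hm _).1 h))
      let ψ : A →+* L := IsLocalization.lift hmu
      have hψ : ∀ g, ψ (algebraMap _ A g) = m g := fun g => IsLocalization.lift_eq hmu g
      have hcomp : ψ.comp (φ : MvPolynomial σ K →+* A) = m := by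
        refine MvPolynomial.ringHom_ext (fun k => ?_) (fun v => ?_)
        · rw [← hψ]
          simp only [RingHom.comp_apply, RingHom.coe_coe]
          rw [hφ]
          exact Subalgebra.algebraMap_mem _ k
        · by_cases hvF : v ∈ F
          · have h0 : m (a v) ≠ 0 := fun h => hap v hvF (hqp ((hm _).1 h))
            have h1 := (hm _).2 (hv v hvF)
            have h2 := congrArg ψ (hφF v hvF)
            rw [map_sub, map_sub, map_mul, map_mul, hφ _ (ha v hvF), hφ _ (hb v hvF), hψ, hψ,
              map_zero, sub_eq_zero] at h2
            rw [map_sub, map_mul, sub_eq_zero, ← h2] at h1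
            exact (mul_left_cancel₀ h0 h1).symm
          · simp [φ, y, ι, hvF, hψ]
      rw [← hm, ← hcomp]
      have hg' : φ g = 0 := hg
      simp [hg']
    have hPle : P ≤ p := hmin p hp le_rfl habp
    have hsup : ∀ g ∈ supported K (F : Set σ)ᶜ, g ∈ P → g = 0 := by
      intro g hg hgP
      have hg' : φ g = 0 := hgP
      rw [hφ g hg] at hg'
      exact (map_eq_zero_iff _ hinj).1 hg'
    have hEF : supported K (F : Set σ)ᶜ ≤ supported K (E : Set σ)ᶜ :=
      supported_mono (Set.compl_subset_compl.2 (by simp [hF]))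
    have hsubF : ∀ v ∈ E, v ∈ F := fun v hv => Finset.mem_insert_of_mem hv
    have hwF : w ∈ F := Finset.mem_insert_self w E
    obtain ⟨Q, hQ, hQP, hQh, -, hQs⟩ := ih P hPp (fun v hv => hEF (ha v (hsubF v hv)))
      (fun v hv => hEF (hb v (hsubF v hv))) (fun v hv h => hap v (hsubF v hv) (hPle h))
      (fun v hv => hφF v (hsubF v hv))
    have hlt : Q < P := by
      refine lt_of_le_of_ne hQP fun h => ?_
      have h1 : a w * X w - b w = 0 := by
        refine hQs _ ?_ (h ▸ hφF w hwF)
        refine sub_mem (mul_mem (hEF (ha w hwF)) ?_) (hEF (hb w hwF))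
        exact X_mem_supported.2 (by simpa using hw)
      have hd : pderiv w (a w * X w - b w) = a w := by
        have hz : ∀ g ∈ supported K (F : Set σ)ᶜ, pderiv w g = 0 := fun g hg =>
          pderiv_eq_zero_of_notMem_vars fun hwg => by
            have := mem_supported.1 hg hwg
            exact this hwF
        simp [hz _ (ha w hwF), hz _ (hb w hwF)]
      rw [h1, map_zero] at hd
      exact hap w hwF (hd ▸ p.zero_mem)
    refine ⟨P, hPp, hPle, le_antisymm ?_ ?_, hφF, hsup⟩
    · have hmem : P ∈ (Ideal.span ((F.image fun v => a v * X v - b v : Finset _) :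
          Set (MvPolynomial σ K))).minimalPrimes := by
        refine ⟨⟨hPp, Ideal.span_le.2 ?_⟩, fun q hq hqP => ?_⟩
        · intro g hg
          obtain ⟨v, hv, rfl⟩ := Finset.mem_image.1 (Finset.mem_coe.1 hg)
          exact hφF v hv
        · exact hmin q hq.1 (hqP.trans hPle) fun v hv =>
            hq.2 (Ideal.subset_span (Finset.mem_coe.2 (Finset.mem_image_of_mem _ hv)))
      exact (Ideal.height_le_card_of_mem_minimalPrimes_span_finset hmem).trans
        (by exact_mod_cast Finset.card_image_le)
    · have := Ideal.height_add_one_le_of_lt_of_isPrime hlt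
      rw [hQh] at this
      rw [hF, Finset.card_insert_of_notMem hw]
      exact_mod_cast this

/-- The prime constructed below is cut out, after inverting the pivots `X (0, π i)`, by the
vanishing of variables and by the minors through the pivot columns. The blocks `S i` with `r i = 1`
are those whose pivot is not in `p`; for the others the whole top row of the block lies in `p`. -/
theorem exists_isPrime_le_height_eq_of_pivots {K : Type*} [Field K] {s c : ℕ}
    (T R₀ R₁ : Finset (Fin s)) (S : Fin c → Finset (Fin s))
    (hTR₀ : Disjoint T R₀) (hTR₁ : Disjoint T R₁)
    (hTS : ∀ i, Disjoint T (S i)) (hR₀S : ∀ i, Disjoint R₀ (S i))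
    (hR₁S : ∀ i, Disjoint R₁ (S i))
    (hSS : ∀ i i', i ≠ i' → Disjoint (S i) (S i'))
    (p : Ideal (MvPolynomial (Fin 2 × Fin s) K)) (hp : p.IsPrime)
    (hpT : ∀ j ∈ T, ∀ k, X (k, j) ∈ p) (hp₀ : ∀ j ∈ R₀, X (0, j) ∈ p)
    (hp₁ : ∀ j ∈ R₁, X (1, j) ∈ p)
    (hpS : ∀ i, ∀ j ∈ S i, ∀ j' ∈ S i, X (0, j) * X (1, j') - X (0, j') * X (1, j) ∈ p)
    (π : Fin c → Fin s) (hπ : ∀ i, π i ∈ S i) (r : Fin c → Fin 2)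
    (hr₀ : ∀ i, r i = 0 → ∀ j ∈ S i, X (0, j) ∈ p)
    (hr₁ : ∀ i, r i = 1 → X (0, π i) ∉ p) :
    ∃ P : Ideal (MvPolynomial (Fin 2 × Fin s) K), P.IsPrime ∧ P ≤ p ∧
      P.height = (2 * T.card + R₀.card + R₁.card + ∑ i : Fin c, ((S i).card - 1) : ℕ) ∧
      (∀ j ∈ T, ∀ k, X (k, j) ∈ P) ∧ (∀ j ∈ R₀, X (0, j) ∈ P) ∧ (∀ j ∈ R₁, X (1, j) ∈ P) ∧
      (∀ i, r i = 1 → ∀ j ∈ S i, ∀ j' ∈ S i,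
        X (0, j) * X (1, j') - X (0, j') * X (1, j) ∈ P) := by
  classical
  let A₁ : Finset (Fin 2 × Fin s) := Finset.univ ×ˢ T
  let A₂ : Finset (Fin 2 × Fin s) := {0} ×ˢ R₀
  let A₃ : Finset (Fin 2 × Fin s) := {1} ×ˢ R₁
  let B : Fin c → Finset (Fin 2 × Fin s) := fun i => {r i} ×ˢ (S i).erase (π i)
  let A₄ : Finset (Fin 2 × Fin s) := Finset.univ.biUnion B
  let E := A₁ ∪ A₂ ∪ A₃ ∪ A₄
  have hE : ∀ k j, (k, j) ∈ E ↔ j ∈ T ∨ (k = 0 ∧ j ∈ R₀) ∨ (k = 1 ∧ j ∈ R₁) ∨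
      ∃ i, k = r i ∧ j ≠ π i ∧ j ∈ S i := by
    intro k j
    simp only [E, A₁, A₂, A₃, A₄, B, Finset.mem_union, Finset.mem_product, Finset.mem_univ,
      Finset.mem_singleton, Finset.mem_biUnion, Finset.mem_erase, true_and, or_assoc]
  have hcard : E.card = 2 * T.card + R₀.card + R₁.card + ∑ i : Fin c, ((S i).card - 1) := by
    have h₄ : A₄.card = ∑ i : Fin c, ((S i).card - 1) := by
      rw [Finset.card_biUnion]
      · simp only [B, Finset.card_product, Finset.card_singleton, one_mul,
          Finset.card_erase_of_mem (hπ _)]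
      · intro i _ i' _ hii'
        exact Finset.disjoint_product.2 (Or.inr ((hSS i i' hii').mono
          (Finset.erase_subset _ _) (Finset.erase_subset _ _)))
    have hd : ∀ (U V : Finset (Fin 2)) (M N : Finset (Fin s)), Disjoint M N →
        Disjoint (U ×ˢ M) (V ×ˢ N) := fun _ _ _ _ h => Finset.disjoint_product.2 (Or.inr h)
    have hdB : ∀ (U : Finset (Fin 2)) (M : Finset (Fin s)), (∀ i, Disjoint M (S i)) →
        Disjoint (U ×ˢ M) A₄ := fun U M h => (Finset.disjoint_biUnion_right _ _ _).2 fun i _ =>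
      hd _ _ _ _ ((h i).mono_right (Finset.erase_subset _ _))
    have h23 : Disjoint A₂ A₃ := Finset.disjoint_product.2 (Or.inl (by simp))
    rw [Finset.card_union_of_disjoint, Finset.card_union_of_disjoint,
      Finset.card_union_of_disjoint, h₄]
    · simp [A₁, A₂, A₃]
    · exact hd _ _ _ _ hTR₀
    · exact Finset.disjoint_union_left.2 ⟨hd _ _ _ _ hTR₁, h23⟩
    · exact Finset.disjoint_union_left.2 ⟨Finset.disjoint_union_left.2
        ⟨hdB _ _ hTS, hdB _ _ hR₀S⟩, hdB _ _ hR₁S⟩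
  have hsing : ∀ i i' j, j ∈ S i → j ∈ S i' → i = i' := fun i i' j h h' => by
    by_contra hne
    exact Finset.disjoint_left.1 (hSS i i' hne) h h'
  have hdT : ∀ i j, j ∈ S i → j ∉ T := fun i j h h' => Finset.disjoint_left.1 (hTS i) h' h
  have hd₀ : ∀ i j, j ∈ S i → j ∉ R₀ := fun i j h h' => Finset.disjoint_left.1 (hR₀S i) h' h
  have hd₁ : ∀ i j, j ∈ S i → j ∉ R₁ := fun i j h h' => Finset.disjoint_left.1 (hR₁S i) h' h
  have htop : ∀ i, r i = 1 → ∀ j ∈ S i, (0, j) ∉ E := by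
    intro i hi j hj h
    rcases (hE _ _).1 h with h | h | h | ⟨i', h, -, h'⟩
    · exact hdT i j hj h
    · exact hd₀ i j hj h.2
    · exact hd₁ i j hj h.2
    · rw [hsing i i' j hj h'] at hi
      rw [hi] at h
      exact zero_ne_one h
  have hpiv : ∀ i k, (k, π i) ∉ E := by
    intro i k h
    rcases (hE _ _).1 h with h | h | h | ⟨i', -, h, h'⟩
    · exact hdT i _ (hπ i) h
    · exact hd₀ i _ (hπ i) h.2
    · exact hd₁ i _ (hπ i) h.2
    · exact h (by rw [hsing i i' _ (hπ i) h'])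
  have hX : ∀ v, v ∉ E → (X v : MvPolynomial (Fin 2 × Fin s) K) ∈
      supported K (E : Set (Fin 2 × Fin s))ᶜ := fun v hv => X_mem_supported.2 (by simpa using hv)
  have key : ∀ v ∈ E, ∃ a b : MvPolynomial (Fin 2 × Fin s) K,
      a ∈ supported K (E : Set (Fin 2 × Fin s))ᶜ ∧ b ∈ supported K (E : Set (Fin 2 × Fin s))ᶜ ∧
      a ∉ p ∧ a * X v - b ∈ p ∧
      (∀ i, v.2 ∈ S i → r i = 1 → a = X (0, π i) ∧ b = X (0, v.2) * X (1, π i)) ∧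
      ((∀ i, v.2 ∉ S i) → a = 1 ∧ b = 0) := by
    rintro ⟨k, j⟩ hv
    by_cases h : ∃ i, j ∈ S i ∧ r i = 1
    · obtain ⟨i, hj, hi⟩ := h
      have hk : k = 1 := by
        have hk0 : k ≠ 0 := by
          rintro rfl
          exact htop i hi j hj hv
        omega
      subst hk
      refine ⟨X (0, π i), X (0, j) * X (1, π i), hX _ (hpiv i 0),
        mul_mem (hX _ (htop i hi j hj)) (hX _ (hpiv i 1)), hr₁ i hi,
        hpS i _ (hπ i) _ hj, fun i' hi' _ => ?_, fun h => absurd hj (h i)⟩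
      rw [hsing i i' j hj hi']
      exact ⟨rfl, rfl⟩
    · refine ⟨1, 0, one_mem _, zero_mem _, p.ne_top_iff_one.1 hp.ne_top, ?_,
        fun i hi hi' => absurd ⟨i, hi, hi'⟩ h, fun _ => ⟨rfl, rfl⟩⟩
      rw [one_mul, sub_zero]
      rcases (hE _ _).1 hv with h' | ⟨rfl, h'⟩ | ⟨rfl, h'⟩ | ⟨i, h', -, hj⟩
      · exact hpT j h' k
      · exact hp₀ j h'
      · exact hp₁ j h'
      · have hi : r i = 0 := by
          have : r i ≠ 1 := fun hi => h ⟨i, hj, hi⟩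
          omega
        rw [h', hi]
        exact hr₀ i hi j hj
  choose! a b ha hb hap habp hS h1 using key
  obtain ⟨P, hP, hPp, hPh, hPE, -⟩ :=
    MvPolynomial.exists_isPrime_le_height_eq_card E a b p hp ha hb hap habp
  have hlin : ∀ k j, (k, j) ∈ E → (∀ i, j ∉ S i) → X (k, j) ∈ P := by
    intro k j hv hj
    have := hPE _ hv
    rwa [(h1 _ hv hj).1, (h1 _ hv hj).2, one_mul, sub_zero] at this
  refine ⟨P, hP, hPp, by rw [hPh, hcard], fun j hj k => ?_, fun j hj => ?_, fun j hj => ?_,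
    fun i hi j hj j' hj' => ?_⟩
  · exact hlin k j ((hE _ _).2 (Or.inl hj)) fun i h => hdT i j h hj
  · exact hlin 0 j ((hE _ _).2 (by simp [hj])) fun i h => hd₀ i j h hj
  · exact hlin 1 j ((hE _ _).2 (by simp [hj])) fun i h => hd₁ i j h hj
  · have hf : ∀ l ∈ S i, X (0, π i) * X (1, l) - X (0, l) * X (1, π i) ∈ P := by
      intro l hl
      by_cases hlπ : l = π i
      · rw [hlπ, sub_self]
        exact P.zero_mem
      · have hv : ((1 : Fin 2), l) ∈ E :=
          (hE _ _).2 (Or.inr (Or.inr (Or.inr ⟨i, hi.symm, hlπ, hl⟩)))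
        have := hPE _ hv
        rwa [(hS _ hv i hl hi).1, (hS _ hv i hl hi).2] at this
    refine (hP.mem_or_mem ?_).resolve_left fun h => hr₁ i hi (hPp h)
    convert! P.sub_mem (P.mul_mem_left (X (0, j)) (hf j' hj'))
      (P.mul_mem_left (X (0, j')) (hf j hj)) using 1
    ring

/-- The affine-chart codimension computation behind Theorem 3.6: the ideal
generated by both entries of the columns in `T`, the top-row entries over `R₀`,
the bottom-row entries over `R₁`, and the 2-minors within each column block
`Sᵢ` has height `2|T| + |R₀| + |R₁| + Σᵢ (|Sᵢ| - 1)`. -/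
theorem stmt_8 (K : Type*) [Field K] (s : ℕ) (hs : 1 ≤ s) (c : ℕ)
    (T R₀ R₁ : Finset (Fin s)) (S : Fin c → Finset (Fin s))
    (hSne : ∀ i, (S i).Nonempty)
    (hTR₀ : Disjoint T R₀) (hTR₁ : Disjoint T R₁) (hR₀R₁ : Disjoint R₀ R₁)
    (hTS : ∀ i, Disjoint T (S i)) (hR₀S : ∀ i, Disjoint R₀ (S i))
    (hR₁S : ∀ i, Disjoint R₁ (S i))
    (hSS : ∀ i i', i ≠ i' → Disjoint (S i) (S i')) :
    idealHeight (Ideal.span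
      ({p : MvPolynomial (Fin 2 × Fin s) K | ∃ j ∈ T, p = X (0, j) ∨ p = X (1, j)} ∪
       {p | ∃ j ∈ R₀, p = X (0, j)} ∪
       {p | ∃ j ∈ R₁, p = X (1, j)} ∪
       {p | ∃ i : Fin c, ∃ j ∈ S i, ∃ j' ∈ S i, j ≠ j' ∧
          p = X (0, j) * X (1, j') - X (0, j') * X (1, j)})) =
      (2 * T.card + R₀.card + R₁.card + ∑ i : Fin c, ((S i).card - 1) : ℕ) := by
  classical
  set I := Ideal.span
      ({p : MvPolynomial (Fin 2 × Fin s) K | ∃ j ∈ T, p = X (0, j) ∨ p = X (1, j)} ∪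
       {p | ∃ j ∈ R₀, p = X (0, j)} ∪
       {p | ∃ j ∈ R₁, p = X (1, j)} ∪
       {p | ∃ i : Fin c, ∃ j ∈ S i, ∃ j' ∈ S i, j ≠ j' ∧
          p = X (0, j) * X (1, j') - X (0, j') * X (1, j)}) with hI
  have hle : ∀ q : Ideal (MvPolynomial (Fin 2 × Fin s) K), I ≤ q ↔
      (∀ j ∈ T, ∀ k, X (k, j) ∈ q) ∧ (∀ j ∈ R₀, X (0, j) ∈ q) ∧ (∀ j ∈ R₁, X (1, j) ∈ q) ∧
      (∀ i, ∀ j ∈ S i, ∀ j' ∈ S i, X (0, j) * X (1, j') - X (0, j') * X (1, j) ∈ q) := by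
    intro q
    rw [hI, Ideal.span_le]
    constructor
    · intro h
      refine ⟨fun j hj k => h ?_, fun j hj => h ?_, fun j hj => h ?_, fun i j hj j' hj' => ?_⟩
      · refine Or.inl (Or.inl (Or.inl ⟨j, hj, ?_⟩))
        fin_cases k <;> simp
      · exact Or.inl (Or.inl (Or.inr ⟨j, hj, rfl⟩))
      · exact Or.inl (Or.inr ⟨j, hj, rfl⟩)
      · by_cases hjj : j = j'
        · rw [hjj, sub_self]
          exact q.zero_mem
        · exact h (Or.inr ⟨i, j, hj, j', hj', hjj, rfl⟩)
    · rintro ⟨h1, h2, h3, h4⟩ g (((⟨j, hj, rfl | rfl⟩ | ⟨j, hj, rfl⟩) | ⟨j, hj, rfl⟩) |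
        ⟨i, j, hj, j', hj', -, rfl⟩)
      · exact h1 j hj 0
      · exact h1 j hj 1
      · exact h2 j hj
      · exact h3 j hj
      · exact h4 i j hj j' hj'
  refine le_antisymm ?_ ?_
  · let pt : Fin 2 × Fin s → K := fun v => if v.1 = 0 ∧ ∃ i, v.2 ∈ S i then 1 else 0
    let p : Ideal (MvPolynomial (Fin 2 × Fin s) K) := RingHom.ker (eval pt)
    have hmem : ∀ g, g ∈ p ↔ eval pt g = 0 := fun g => Iff.rfl
    choose π hπ using hSne
    obtain ⟨P, hP, -, hPh, h1, h2, h3, h4⟩ := exists_isPrime_le_height_eq_of_pivots T R₀ R₁ S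
      hTR₀ hTR₁ hTS hR₀S hR₁S hSS p (RingHom.ker_isPrime _)
      (fun j hj k => by
        have : ∀ i, j ∉ S i := fun i => Finset.disjoint_left.1 (hTS i) hj
        simp [hmem, pt, this])
      (fun j hj => by
        have : ∀ i, j ∉ S i := fun i => Finset.disjoint_left.1 (hR₀S i) hj
        simp [hmem, pt, this])
      (fun j hj => by simp [hmem, pt]) (fun i j hj j' hj' => by simp [hmem, pt])
      π hπ (fun _ => 1) (fun i hi => absurd hi one_ne_zero)
      (fun i _ => by
        have : ∃ i', π i ∈ S i' := ⟨i, hπ i⟩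
        simp [hmem, pt, this])
    refine (iInf₂_le (⟨P, hP⟩ : PrimeSpectrum _)
      ((hle P).2 ⟨h1, h2, h3, fun i => h4 i rfl⟩)).trans ?_
    rw [← PrimeSpectrum.height_eq_orderHeight]
    exact hPh.le
  · refine le_iInf₂ fun p hp => ?_
    rw [← PrimeSpectrum.height_eq_orderHeight]
    obtain ⟨h1, h2, h3, h4⟩ := (hle p.asIdeal).1 hp
    have hpiv : ∀ i, ∃ π ∈ S i, ∃ r : Fin 2,
        (r = 0 → ∀ j ∈ S i, (X (0, j) : MvPolynomial (Fin 2 × Fin s) K) ∈ p.asIdeal) ∧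
        (r = 1 → (X (0, π) : MvPolynomial (Fin 2 × Fin s) K) ∉ p.asIdeal) := by
      intro i
      by_cases h : ∀ j ∈ S i, (X (0, j) : MvPolynomial (Fin 2 × Fin s) K) ∈ p.asIdeal
      · obtain ⟨j, hj⟩ := hSne i
        exact ⟨j, hj, 0, fun _ => h, fun h => absurd h zero_ne_one⟩
      · push Not at h
        obtain ⟨j, hj, hjp⟩ := h
        exact ⟨j, hj, 1, fun h => absurd h one_ne_zero, fun _ => hjp⟩
    choose π hπ r hr₀ hr₁ using hpiv
    obtain ⟨P, -, hPp, hPh, -⟩ := exists_isPrime_le_height_eq_of_pivots T R₀ R₁ S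
      hTR₀ hTR₁ hTS hR₀S hR₁S hSS p.asIdeal p.isPrime h1 h2 h3 h4 π hπ r hr₀ hr₁
    rw [← hPh]
    exact Ideal.height_mono hPp
end

section
/- Let n ≥ 3 and let G, H be simple graphs on the vertex set Fin n such that: G and H are both permissible, G ⊔ H = ⊤ (every pair of distinct vertices is adjacent in G or in H), and the pair (G, H) is minimal, meaning that whenever G' ≤ G and H' ≤ H are permissible graphs with G' ⊔ H' = ⊤, one has G' = G and H' = H. Then H is the complement of G, and there exists a finite set S of vertices with 2 ≤ |S| ≤ n − 1 such that either (a) two vertices are adjacent in G if and only if they are distinct and both lie in S (so G is a clique on S with all other vertices isolated, and H is its complement, in which the n−|S| vertices outside S are dominating), or (b) the same holds with the roles of G and H interchanged. -/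
/-- A simple graph on `n` vertices is permissible if it is not complete and
adjacency is transitive among distinct non-dominating vertices (vertices of
degree `≠ n - 1`), i.e. the induced subgraph on the non-dominating vertices is
a disjoint union of cliques. -/
def IsPermissible {n : ℕ} (G : SimpleGraph (Fin n)) : Prop :=
  G ≠ ⊤ ∧
  ∀ u v w : Fin n, (G.neighborSet u).ncard ≠ n - 1 → (G.neighborSet v).ncard ≠ n - 1 →
    (G.neighborSet w).ncard ≠ n - 1 → u ≠ w → G.Adj u v → G.Adj v w → G.Adj u w

/-- The graph whose edges are the pairs of distinct vertices of `S`. -/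
def cliqueOn {V : Type*} (S : Finset V) : SimpleGraph V where
  Adj i j := i ≠ j ∧ i ∈ S ∧ j ∈ S
  symm := ⟨fun _ _ h => ⟨h.1.symm, h.2.2, h.2.1⟩⟩
  loopless := ⟨fun _ h => h.1 rfl⟩

theorem ncard_neighborSet_eq_pred_iff {n : ℕ} (G : SimpleGraph (Fin n)) (u : Fin n) :
    (G.neighborSet u).ncard = n - 1 ↔ ∀ w, u ≠ w → G.Adj u w := by
  have hsub : G.neighborSet u ⊆ ({u}ᶜ : Set (Fin n)) := fun w hw => (G.ne_of_adj hw).symm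
  have hcard : ({u}ᶜ : Set (Fin n)).ncard = n - 1 := by
    rw [Set.ncard_compl]; simp
  constructor
  · intro h w hw
    have heq := Set.eq_of_subset_of_ncard_le hsub (by omega)
    have hmem : w ∈ ({u}ᶜ : Set (Fin n)) := hw.symm
    rwa [← heq] at hmem
  · intro h
    rw [← hcard, hsub.antisymm fun w hw => h w (Ne.symm hw)]

theorem isPermissible_iff {n : ℕ} (G : SimpleGraph (Fin n)) :
    IsPermissible G ↔ G ≠ ⊤ ∧ ∀ u v w : Fin n, (∃ x, u ≠ x ∧ ¬ G.Adj u x) →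
      (∃ x, v ≠ x ∧ ¬ G.Adj v x) → (∃ x, w ≠ x ∧ ¬ G.Adj w x) →
      u ≠ w → G.Adj u v → G.Adj v w → G.Adj u w := by
  simp only [IsPermissible, ne_eq, ncard_neighborSet_eq_pred_iff, not_forall, exists_prop]

theorem exists_nonadj_of_ne_top {V : Type*} {G : SimpleGraph V} (h : G ≠ ⊤) :
    ∃ i j, i ≠ j ∧ ¬ G.Adj i j := by
  by_contra! hc
  exact h (SimpleGraph.ext_iff.2 (by ext i j; exact ⟨fun h => h.ne, fun h => hc i j h⟩))

theorem isPermissible_cliqueOn {n : ℕ} {S : Finset (Fin n)} {a : Fin n} (ha : a ∉ S)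
    (hS : S.Nonempty) : IsPermissible (cliqueOn S) := by
  obtain ⟨b, hb⟩ := hS
  refine ⟨fun h => ?_, fun u v w _ _ _ huw huv hvw => ⟨huw, huv.2.1, hvw.2.2⟩⟩
  have hab : (cliqueOn S).Adj a b := by
    rw [h]
    rintro rfl
    exact ha hb
  exact ha hab.2.1

theorem isPermissible_compl_cliqueOn {n : ℕ} {S : Finset (Fin n)} {a b : Fin n}
    (hab : a ≠ b) (ha : a ∈ S) (hb : b ∈ S) : IsPermissible (cliqueOn S)ᶜ := by
  rw [isPermissible_iff]
  refine ⟨fun h => ?_, fun u v w hu hv _ _ huv _ => ?_⟩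
  · have : (cliqueOn S)ᶜ.Adj a b := by
      rw [h]
      exact hab
    exact this.2 ⟨hab, ha, hb⟩
  · obtain ⟨x, hx, hux⟩ := hu
    obtain ⟨y, hy, hvy⟩ := hv
    simp only [SimpleGraph.compl_adj, cliqueOn] at hux hvy huv
    tauto

theorem pair_eq_cliqueOn_compl {n : ℕ} {G H : SimpleGraph (Fin n)}
    (hG : G ≠ ⊤) (hH : H ≠ ⊤)
    (hmin : ∀ G' H' : SimpleGraph (Fin n), G' ≤ G → H' ≤ H →
      IsPermissible G' → IsPermissible H' → G' ⊔ H' = ⊤ → G' = G ∧ H' = H)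
    (hclique : ∀ u v, (∃ x, u ≠ x ∧ ¬ H.Adj u x) → (∃ x, v ≠ x ∧ ¬ H.Adj v x) →
      u ≠ v → G.Adj u v) :
    ∃ S : Finset (Fin n), 2 ≤ S.card ∧ S.card ≤ n - 1 ∧ G = cliqueOn S ∧
      H = (cliqueOn S)ᶜ := by
  classical
  obtain ⟨i, j, hij, hGij⟩ := exists_nonadj_of_ne_top hG
  obtain ⟨a, b, hab, hHab⟩ := exists_nonadj_of_ne_top hH
  let S : Finset (Fin n) := {u | ∃ x, u ≠ x ∧ ¬ H.Adj u x}
  have mem_S (u) : u ∈ S ↔ ∃ x, u ≠ x ∧ ¬ H.Adj u x := by simp [S]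
  have ha : a ∈ S := (mem_S a).2 ⟨b, hab, hHab⟩
  have hb : b ∈ S := (mem_S b).2 ⟨a, hab.symm, fun h => hHab h.symm⟩
  obtain ⟨c, hc⟩ : ∃ c, c ∉ S := by
    by_contra! hall
    exact hGij (hclique i j ((mem_S i).1 (hall i)) ((mem_S j).1 (hall j)) hij)
  obtain ⟨h₁, h₂⟩ := hmin (cliqueOn S) (cliqueOn S)ᶜ
    (fun u v h => hclique u v ((mem_S u).1 h.2.1) ((mem_S v).1 h.2.2) h.1)
    (fun u v h => by
      by_contra hn
      exact h.2 ⟨h.1, (mem_S u).2 ⟨v, h.1, hn⟩, (mem_S v).2 ⟨u, h.1.symm, fun h' => hn h'.symm⟩⟩)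
    (isPermissible_cliqueOn hc ⟨a, ha⟩) (isPermissible_compl_cliqueOn hab ha hb) sup_compl_eq_top
  refine ⟨S, Finset.one_lt_card.2 ⟨a, ha, b, hb, hab⟩, ?_, h₁.symm, h₂.symm⟩
  have hlt := Finset.card_lt_univ_of_notMem hc
  rw [Fintype.card_fin] at hlt
  omega

theorem nonDominating_clique_or {n : ℕ} {G H : SimpleGraph (Fin n)}
    (hG : IsPermissible G) (hH : IsPermissible H) (hcov : G ⊔ H = ⊤) :
    (∀ u v, (∃ x, u ≠ x ∧ ¬ H.Adj u x) → (∃ x, v ≠ x ∧ ¬ H.Adj v x) → u ≠ v → G.Adj u v) ∨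
    (∀ u v, (∃ x, u ≠ x ∧ ¬ G.Adj u x) → (∃ x, v ≠ x ∧ ¬ G.Adj v x) → u ≠ v → H.Adj u v) := by
  have cover (i j) (hij : i ≠ j) : G.Adj i j ∨ H.Adj i j := by
    rw [← SimpleGraph.sup_adj, hcov]
    exact hij
  obtain ⟨-, hG⟩ := (isPermissible_iff G).1 hG
  obtain ⟨-, hH⟩ := (isPermissible_iff H).1 hH
  by_contra! hcon
  obtain ⟨⟨u, v, hu, hv, huv, hGuv⟩, p, q, hp, hq, hpq, hHpq⟩ := hcon
  have hHuv : H.Adj u v := (cover u v huv).resolve_left hGuv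
  have hGu : ∃ x, u ≠ x ∧ ¬ G.Adj u x := ⟨v, huv, hGuv⟩
  have hGv : ∃ x, v ≠ x ∧ ¬ G.Adj v x := ⟨u, huv.symm, fun h => hGuv h.symm⟩
  have hHp : ∃ x, p ≠ x ∧ ¬ H.Adj p x := ⟨q, hpq, hHpq⟩
  have hHq : ∃ x, q ≠ x ∧ ¬ H.Adj q x := ⟨p, hpq.symm, fun h => hHpq h.symm⟩
  have same_clique (w) (hw : ∃ x, w ≠ x ∧ ¬ G.Adj w x) (hw' : ∃ x, w ≠ x ∧ ¬ H.Adj w x) :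
      u = w ∨ H.Adj u w := by
    by_contra! hc
    obtain ⟨huw, hHuw⟩ := hc
    have hvw : v ≠ w := by
      rintro rfl
      exact hHuw hHuv
    have hHvw : ¬ H.Adj v w := fun h => hHuw (hH u v w hu hv hw' huw hHuv h)
    exact hGuv (hG u w v hGu hw hGv huv ((cover u w huw).resolve_right hHuw)
      ((cover v w hvw).resolve_right hHvw).symm)
  rcases same_clique p hp hHp with rfl | hup
  · rcases same_clique q hq hHq with rfl | huq
    · exact hpq rfl
    · exact hHpq huq
  · rcases same_clique q hq hHq with rfl | huq
    · exact hHpq hup.symm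
    · exact hHpq (hH p u q hHp hu hHq hpq hup.symm huq)

/-- Theorem 3.7 (classification half): a minimal pair of permissible graphs
covering the complete graph consists of a clique on a set `S` of vertices
(with `2 ≤ |S| ≤ n - 1`, all other vertices isolated) and its complement. -/
theorem stmt_9 (n : ℕ) (hn : 3 ≤ n) (G H : SimpleGraph (Fin n))
    (hG : IsPermissible G) (hH : IsPermissible H) (hcov : G ⊔ H = ⊤)
    (hmin : ∀ G' H' : SimpleGraph (Fin n), G' ≤ G → H' ≤ H →
      IsPermissible G' → IsPermissible H' → G' ⊔ H' = ⊤ → G' = G ∧ H' = H) :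
    H = Gᶜ ∧ ∃ S : Finset (Fin n), 2 ≤ S.card ∧ S.card ≤ n - 1 ∧
      ((∀ i j : Fin n, G.Adj i j ↔ i ≠ j ∧ i ∈ S ∧ j ∈ S) ∨
       (∀ i j : Fin n, H.Adj i j ↔ i ≠ j ∧ i ∈ S ∧ j ∈ S)) := by
  rcases nonDominating_clique_or hG hH hcov with h | h
  · obtain ⟨S, h₂, hS, rfl, rfl⟩ := pair_eq_cliqueOn_compl hG.1 hH.1 hmin h
    exact ⟨rfl, S, h₂, hS, Or.inl fun _ _ => Iff.rfl⟩
  · obtain ⟨S, h₂, hS, rfl, rfl⟩ := pair_eq_cliqueOn_compl hH.1 hG.1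
      (fun H' G' hH' hG' pH pG hc => (hmin G' H' hG' hH' pG pH (sup_comm G' H' ▸ hc)).symm) h
    exact ⟨(compl_compl _).symm, S, h₂, hS, Or.inr fun _ _ => Iff.rfl⟩
end

section
/- Let K be a field and R = MvPolynomial (Fin 3 × Fin 3) K, the polynomial ring in the entries x_{ij} = X (i, j) of a generic 3×3 matrix X, and let Δ = det X ∈ R. Let (i₁, i₂, i₃) and (j₁, j₂, j₃) each be an enumeration of the three elements of Fin 3 (given by permutations of Fin 3), and let μ = x_{i₁j₁} x_{i₂j₂} − x_{i₁j₂} x_{i₂j₁}. Then the ideal I = Ideal.span {Δ, μ} has exactly two minimal primes, namely: P₁ = Ideal.span {μ, x_{i₁j₁} x_{i₂j₃} − x_{i₁j₃} x_{i₂j₁}, x_{i₁j₂} x_{i₂j₃} − x_{i₁j₃} x_{i₂j₂}} (the 2-minors on rows i₁, i₂) and P₂ = Ideal.span {μ, x_{i₁j₁} x_{i₃j₂} − x_{i₁j₂} x_{i₃j₁}, x_{i₂j₁} x_{i₃j₂} − x_{i₂j₂} x_{i₃j₁}} (the 2-minors on columns j₁, j₂); that is, I.minimalPrimes = {P₁,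 P₂}. -/
open MvPolynomial

namespace MvPolynomial

variable {ι κ R : Type*} [CommRing R]

lemma aeval_monomial_monomial (a : ι → κ →₀ ℕ) (m : ι →₀ ℕ) (c : R) :
    aeval (fun p => monomial (a p) (1 : R)) (monomial m c) =
      monomial (Finsupp.linearCombination ℕ a m) c := by
  classical
  induction m using Finsupp.induction_linear generalizing c with
  | zero => simp [← C_apply]
  | add f g hf hg =>
    rw [← mul_one c, ← monomial_mul, map_mul, hf, hg, monomial_mul, map_add]
  | single p k =>
    rw [aeval_monomial, Finsupp.prod_single_index (by exact pow_zero _),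
      Finsupp.linearCombination_single, monomial_pow, one_pow, algebraMap_eq, C_mul_monomial, mul_one]

/-- The kernel of a monomial map lies in every ideal containing all the binomials
`x ^ m - x ^ m'` whose two terms have the same image. -/
lemma ker_aeval_monomial_le (a : ι → κ →₀ ℕ) (P : Ideal (MvPolynomial ι R))
    (hP : ∀ m m', Finsupp.linearCombination ℕ a m = Finsupp.linearCombination ℕ a m' →
      monomial m (1 : R) - monomial m' 1 ∈ P) :
    RingHom.ker (aeval (R := R) fun p => monomial (a p) (1 : R)) ≤ P := by
  let A := Finsupp.linearCombination ℕ a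
  let g : MvPolynomial κ R →ₗ[R] MvPolynomial ι R :=
    (basisMonomials κ R).constr R fun t => monomial (Function.invFun A t) 1
  have hg (t : κ →₀ ℕ) (c : R) : g (monomial t c) = monomial (Function.invFun A t) c := by
    have := (basisMonomials κ R).constr_basis R
      (fun t => monomial (Function.invFun A t) (1 : R)) t
    rw [coe_basisMonomials] at this
    rw [← mul_one c, ← smul_eq_mul, ← smul_monomial, map_smul, this, smul_monomial]
  have key (f : MvPolynomial ι R) :
      f - g (aeval (fun p => monomial (a p) (1 : R)) f) ∈ P := by
    induction f using induction_on' with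
    | monomial m c =>
      rw [aeval_monomial_monomial, hg]
      have := P.mul_mem_left (C c) (hP m (Function.invFun A (A m))
        (Function.invFun_eq (f := A) ⟨m, rfl⟩).symm)
      simpa [mul_sub, C_mul_monomial] using this
    | add p q hp hq =>
      rw [map_add, map_add, add_sub_add_comm]
      exact P.add_mem hp hq
  intro f hf
  have hf0 : aeval (fun p => monomial (a p) (1 : R)) f = 0 := hf
  have hf' := key f
  rwa [hf0, map_zero, sub_zero] at hf'

section Minors

variable {m n : Type*} (e : m × n ↪ ι)

/-- Exponents of the monomial parametrization of rank one matrices: the entry `e (i, j)` goes to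
`u i * v j`, and every variable outside the matrix goes to a variable of its own. -/
noncomputable def segreExponent : ι → (m ⊕ n ⊕ ι →₀ ℕ) :=
  Function.extend e
    (fun q => Finsupp.single (Sum.inl q.1) 1 + Finsupp.single (Sum.inr (Sum.inl q.2)) 1)
    (fun p => Finsupp.single (Sum.inr (Sum.inr p)) 1)

lemma segreExponent_apply (i : m) (j : n) : segreExponent e (e (i, j)) =
    Finsupp.single (Sum.inl i) 1 + Finsupp.single (Sum.inr (Sum.inl j)) 1 :=
  e.injective.extend_apply _ _ _

lemma segreExponent_of_notMem {p : ι} (hp : p ∉ Set.range e) :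
    segreExponent e p = Finsupp.single (Sum.inr (Sum.inr p)) 1 :=
  Function.extend_apply' _ _ _ hp

lemma segreExponent_inl_ne_zero {p : ι} {i : m} (h : segreExponent e p (Sum.inl i) ≠ 0) :
    ∃ j, p = e (i, j) := by
  classical
  by_cases hp : p ∈ Set.range e
  · obtain ⟨⟨i', j⟩, rfl⟩ := hp
    simp [segreExponent_apply, Finsupp.single_apply] at h
    exact ⟨j, by rw [h]⟩
  · simp [segreExponent_of_notMem e hp] at h

lemma segreExponent_inr_inl_ne_zero {p : ι} {j : n}
    (h : segreExponent e p (Sum.inr (Sum.inl j)) ≠ 0) : ∃ i, p = e (i, j) := by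
  classical
  by_cases hp : p ∈ Set.range e
  · obtain ⟨⟨i, j'⟩, rfl⟩ := hp
    simp [segreExponent_apply, Finsupp.single_apply] at h
    exact ⟨i, by rw [h]⟩
  · simp [segreExponent_of_notMem e hp] at h

lemma segreExponent_inr_inr_ne_zero {p q : ι}
    (h : segreExponent e p (Sum.inr (Sum.inr q)) ≠ 0) : p = q := by
  classical
  by_cases hp : p ∈ Set.range e
  · obtain ⟨⟨i, j'⟩, rfl⟩ := hp
    simp [segreExponent_apply] at h
  · simpa [segreExponent_of_notMem e hp, Finsupp.single_apply] using h

lemma segreExponent_ne_zero (p : ι) : segreExponent e p ≠ 0 := by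
  classical
  by_cases hp : p ∈ Set.range e
  · obtain ⟨⟨i, j⟩, rfl⟩ := hp
    simp [segreExponent_apply]
  · simp [segreExponent_of_notMem e hp]

lemma exists_ne_zero_of_linearCombination_ne_zero {a : ι → κ →₀ ℕ} {s : ι →₀ ℕ} {t : κ}
    (h : Finsupp.linearCombination ℕ a s t ≠ 0) : ∃ p, s p ≠ 0 ∧ a p t ≠ 0 := by
  by_contra! hc
  refine h ?_
  rw [Finsupp.linearCombination_apply, Finsupp.sum, Finsupp.finsetSum_apply]
  refine Finset.sum_eq_zero fun p hp => ?_
  simp [hc p (Finsupp.mem_support_iff.mp hp)]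

lemma exists_eq_single_add {s : ι →₀ ℕ} {p : ι} (h : s p ≠ 0) :
    ∃ r, s = Finsupp.single p 1 + r :=
  ⟨s - Finsupp.single p 1, (add_tsub_cancel_of_le (by
    classical
    intro q
    by_cases hq : p = q
    · subst hq; simpa using Nat.one_le_iff_ne_zero.mpr h
    · simp [hq])).symm⟩

variable (R) in
/-- The ideal generated by the 2-minors of the matrix of distinct variables `X (e (i, j))`. -/
noncomputable def twoMinors : Ideal (MvPolynomial ι R) :=
  Ideal.span {f | ∃ i i' j j', f = X (e (i, j)) * X (e (i', j')) - X (e (i, j')) * X (e (i', j))}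

/-- A monomial whose image under the Segre parametrization is divisible by that of `X p` is,
modulo the 2-minors, a multiple of `X p`. -/
lemma exists_single_add_sub_mem_twoMinors {p : ι} {s t : ι →₀ ℕ}
    (h : Finsupp.linearCombination ℕ (segreExponent e) (Finsupp.single p 1 + s) =
      Finsupp.linearCombination ℕ (segreExponent e) t) :
    ∃ r, Finsupp.linearCombination ℕ (segreExponent e) (Finsupp.single p 1 + r) =
        Finsupp.linearCombination ℕ (segreExponent e) t ∧
      monomial (Finsupp.single p 1 + r) (1 : R) - monomial t 1 ∈ twoMinors R e := by
  classical
  have of_ne (ht : t p ≠ 0) : ∃ r, Finsupp.linearCombination ℕ (segreExponent e)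
        (Finsupp.single p 1 + r) = Finsupp.linearCombination ℕ (segreExponent e) t ∧
      monomial (Finsupp.single p 1 + r) (1 : R) - monomial t 1 ∈ twoMinors R e := by
    obtain ⟨r, rfl⟩ := exists_eq_single_add ht
    exact ⟨r, rfl, by simp⟩
  have hle (c : m ⊕ n ⊕ ι) (hc : segreExponent e p c ≠ 0) :
      ∃ q, t q ≠ 0 ∧ segreExponent e q c ≠ 0 := by
    apply exists_ne_zero_of_linearCombination_ne_zero
    rw [← h]
    simp [hc]
  by_cases hp : p ∈ Set.range e
  · obtain ⟨⟨i, j⟩, rfl⟩ := hp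
    obtain ⟨q, hq, hqi⟩ := hle (Sum.inl i) (by simp [segreExponent_apply])
    obtain ⟨k, rfl⟩ := segreExponent_inl_ne_zero e hqi
    obtain ⟨q', hq', hqj⟩ := hle (Sum.inr (Sum.inl j)) (by simp [segreExponent_apply])
    obtain ⟨l, rfl⟩ := segreExponent_inr_inl_ne_zero e hqj
    by_cases hli : l = i
    · exact of_ne (hli ▸ hq')
    obtain ⟨t, rfl⟩ := exists_eq_single_add hq
    have hne : e (i, k) ≠ e (l, j) := fun h' => hli (by simpa using (congrArg Prod.fst
      (e.injective h')).symm)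
    obtain ⟨t, rfl⟩ := exists_eq_single_add (s := t) (p := e (l, j)) (by simpa [hne] using hq')
    refine ⟨Finsupp.single (e (l, k)) 1 + t, ?_, ?_⟩
    · simp only [map_add, Finsupp.linearCombination_single, segreExponent_apply]
      abel
    · have : X (e (i, j)) * X (e (l, k)) - X (e (i, k)) * X (e (l, j)) ∈ twoMinors R e :=
        Ideal.subset_span ⟨i, l, j, k, rfl⟩
      have := Ideal.mul_mem_right (monomial t 1) _ this
      simpa [sub_mul, X, monomial_mul, add_assoc] using this
  · obtain ⟨q, hq, hqp⟩ := hle (Sum.inr (Sum.inr p)) (by simp [segreExponent_of_notMem e hp])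
    exact of_ne (segreExponent_inr_inr_ne_zero e hqp ▸ hq)

lemma monomial_sub_monomial_mem_twoMinors (s t : ι →₀ ℕ)
    (h : Finsupp.linearCombination ℕ (segreExponent e) s =
      Finsupp.linearCombination ℕ (segreExponent e) t) :
    monomial s (1 : R) - monomial t 1 ∈ twoMinors R e := by
  induction hd : s.degree generalizing s t with
  | zero =>
    obtain rfl : s = 0 := (Finsupp.degree_eq_zero_iff s).mp hd
    obtain rfl : t = 0 := by
      by_contra ht
      obtain ⟨p, hp⟩ := Finsupp.ne_iff.mp ht
      obtain ⟨r, rfl⟩ := exists_eq_single_add hp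
      refine segreExponent_ne_zero e p ?_
      simp only [map_zero, map_add, Finsupp.linearCombination_single, one_smul] at h
      exact (add_eq_zero.mp h.symm).1
    simp
  | succ d ih =>
    obtain ⟨p, hp⟩ : ∃ p, s p ≠ 0 := by
      by_contra! hs
      obtain rfl : s = 0 := Finsupp.ext hs
      simp at hd
    obtain ⟨s, rfl⟩ := exists_eq_single_add hp
    obtain ⟨r, hr, hmem⟩ := exists_single_add_sub_mem_twoMinors (R := R) e h
    have hsr := ih s r (by simpa using h.trans hr.symm)
      (by simp only [map_add, Finsupp.degree_single] at hd; lia)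
    have hX := Ideal.mul_mem_left _ (X p) hsr
    have := Ideal.add_mem _ hX hmem
    simpa [mul_sub, X, monomial_mul] using this

/-- The ideal of 2-minors of a generic matrix is prime. -/
theorem twoMinors_isPrime [IsDomain R] : (twoMinors R e).IsPrime := by
  have : twoMinors R e =
      RingHom.ker (aeval (R := R) fun p => monomial (segreExponent e p) (1 : R)) := by
    refine le_antisymm (Ideal.span_le.mpr ?_)
      (ker_aeval_monomial_le _ _ (monomial_sub_monomial_mem_twoMinors e))
    rintro _ ⟨i, i', j, j', rfl⟩
    simp only [SetLike.mem_coe, RingHom.mem_ker, map_sub, map_mul, aeval_X, monomial_mul,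
      segreExponent_apply, sub_eq_zero]
    congr 2
    abel
  rw [this]
  exact RingHom.ker_isPrime _

/-- The 2-minors of a `2 × 3` matrix are generated by those with increasing columns. -/
lemma twoMinors_fin_two_three (e : Fin 2 × Fin 3 ↪ ι) : twoMinors R e = Ideal.span
    {X (e (0, 0)) * X (e (1, 1)) - X (e (0, 1)) * X (e (1, 0)),
     X (e (0, 0)) * X (e (1, 2)) - X (e (0, 2)) * X (e (1, 0)),
     X (e (0, 1)) * X (e (1, 2)) - X (e (0, 2)) * X (e (1, 1))} := by
  refine le_antisymm (Ideal.span_le.mpr ?_) (Ideal.span_mono ?_)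
  · set J : Ideal (MvPolynomial ι R) := Ideal.span _ with hJ
    have h01 : X (e (0, 0)) * X (e (1, 1)) - X (e (0, 1)) * X (e (1, 0)) ∈ J :=
      Ideal.subset_span (by simp)
    have h02 : X (e (0, 0)) * X (e (1, 2)) - X (e (0, 2)) * X (e (1, 0)) ∈ J :=
      Ideal.subset_span (by simp)
    have h12 : X (e (0, 1)) * X (e (1, 2)) - X (e (0, 2)) * X (e (1, 1)) ∈ J :=
      Ideal.subset_span (by simp)
    clear_value J
    have key (j j' : Fin 3) : X (e (0, j)) * X (e (1, j')) - X (e (0, j')) * X (e (1, j)) ∈ J := by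
      fin_cases j <;> fin_cases j' <;>
        first
        | simp; done
        | assumption
        | (rw [← neg_mem_iff, neg_sub]; assumption)
    rintro _ ⟨i, i', j, j', rfl⟩
    fin_cases i <;> fin_cases i'
    · simp [mul_comm]
    · exact key j j'
    · have := key j' j
      simpa [mul_comm] using this
    · simp [mul_comm]
  · rintro _ (rfl | rfl | rfl)
    exacts [⟨0, 1, 0, 1, rfl⟩, ⟨0, 1, 0, 2, rfl⟩, ⟨0, 1, 1, 2, rfl⟩]

end Minors

end MvPolynomial

lemma Ideal.minimalPrimes_eq_pair {R : Type*} [CommRing R] {I P Q : Ideal R}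
    (hP : P.IsPrime) (hQ : Q.IsPrime) (hIP : I ≤ P) (hIQ : I ≤ Q) (hPQ : ¬ P ≤ Q) (hQP : ¬ Q ≤ P)
    (h : ∀ J : Ideal R, J.IsPrime → I ≤ J → P ≤ J ∨ Q ≤ J) : I.minimalPrimes = {P, Q} := by
  ext J
  simp only [Set.mem_insert_iff, Set.mem_singleton_iff]
  constructor
  · intro hJ
    rcases h J hJ.1.1 hJ.1.2 with hle | hle
    · exact Or.inl (le_antisymm (hJ.2 ⟨hP, hIP⟩ hle) hle)
    · exact Or.inr (le_antisymm (hJ.2 ⟨hQ, hIQ⟩ hle) hle)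
  · rintro (rfl | rfl)
    · exact ⟨⟨hP, hIP⟩, fun L hL hle =>
        (h L hL.1 hL.2).resolve_right fun hQL => hQP (hQL.trans hle)⟩
    · exact ⟨⟨hQ, hIQ⟩, fun L hL hle =>
        (h L hL.1 hL.2).resolve_left fun hPL => hPQ (hPL.trans hle)⟩

lemma Matrix.span_det_submatrix_perm {R : Type*} [CommRing R] {n : Type*} [Fintype n]
    [DecidableEq n] (A : Matrix n n R) (σ τ : Equiv.Perm n) (b : R) :
    Ideal.span {(A.submatrix σ τ).det, b} = Ideal.span {A.det, b} := by
  have hdet : (A.submatrix σ τ).det =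
      ((Equiv.Perm.sign σ * Equiv.Perm.sign τ : ℤˣ) : ℤ) * A.det := by
    have : A.submatrix σ τ = (A.submatrix σ id).submatrix id τ := rfl
    rw [this, Matrix.det_permute', Matrix.det_permute]
    push_cast
    ring
  rcases Int.units_eq_one_or (Equiv.Perm.sign σ * Equiv.Perm.sign τ) with hs | hs <;>
    rw [hs] at hdet
  · simp [hdet]
  · simp [hdet, Ideal.span_insert, Ideal.span_singleton_neg]



/-- Proposition 3.8 (case3): for the generic 3×3 matrix `X`, the ideal
generated by `det X` and a nested 2-minor `μ` (on rows `i₁, i₂` and columns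
`j₁, j₂`) has exactly two minimal primes: the 2-minors on rows `i₁, i₂` and the
2-minors on columns `j₁, j₂`. Enumerations of rows and columns are given by
permutations `σ, τ` of `Fin 3`, with `iₖ = σ (k-1)` and `jₖ = τ (k-1)`. -/
theorem stmt_12 (K : Type*) [Field K] (σ τ : Equiv.Perm (Fin 3)) :
    (Ideal.span
      {(Matrix.of fun i j : Fin 3 =>
          (X (i, j) : MvPolynomial (Fin 3 × Fin 3) K)).det,
       X (σ 0, τ 0) * X (σ 1, τ 1) - X (σ 0, τ 1) * X (σ 1, τ 0)}).minimalPrimes =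
    {Ideal.span
      {(X (σ 0, τ 0) * X (σ 1, τ 1) - X (σ 0, τ 1) * X (σ 1, τ 0) :
          MvPolynomial (Fin 3 × Fin 3) K),
       X (σ 0, τ 0) * X (σ 1, τ 2) - X (σ 0, τ 2) * X (σ 1, τ 0),
       X (σ 0, τ 1) * X (σ 1, τ 2) - X (σ 0, τ 2) * X (σ 1, τ 1)},
     Ideal.span
      {(X (σ 0, τ 0) * X (σ 1, τ 1) - X (σ 0, τ 1) * X (σ 1, τ 0) :
          MvPolynomial (Fin 3 × Fin 3) K),
       X (σ 0, τ 0) * X (σ 2, τ 1) - X (σ 0, τ 1) * X (σ 2, τ 0),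
       X (σ 1, τ 0) * X (σ 2, τ 1) - X (σ 1, τ 1) * X (σ 2, τ 0)}} := by
  rw [← Matrix.span_det_submatrix_perm _ σ τ]
  let e₁ : Fin 2 × Fin 3 ↪ Fin 3 × Fin 3 :=
    ⟨fun q => (σ q.1.castSucc, τ q.2), fun p q h => by
      simpa [Prod.ext_iff] using h⟩
  let e₂ : Fin 2 × Fin 3 ↪ Fin 3 × Fin 3 :=
    ⟨fun q => (σ q.2, τ q.1.castSucc), fun p q h => by
      simpa [Prod.ext_iff, and_comm] using h⟩
  refine Ideal.minimalPrimes_eq_pair ?_ ?_ ?_ ?_ ?_ ?_ ?_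
  · exact twoMinors_fin_two_three (R := K) e₁ ▸ twoMinors_isPrime e₁
  · have h := twoMinors_fin_two_three (R := K) e₂ ▸ twoMinors_isPrime e₂
    rw [mul_comm (X (e₂ (0, 1))) (X (e₂ (1, 0))), mul_comm (X (e₂ (0, 2))) (X (e₂ (1, 0))),
      mul_comm (X (e₂ (0, 2))) (X (e₂ (1, 1)))] at h
    exact h
  · rw [Ideal.span_le]
    rintro _ (rfl | rfl)
    · refine Ideal.mem_span_insert.mpr ⟨X (σ 2, τ 2), _, Ideal.mem_span_pair.mpr
        ⟨-X (σ 2, τ 1), X (σ 2, τ 0), rfl⟩, ?_⟩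
      simp only [Matrix.det_fin_three, Matrix.submatrix_apply, Matrix.of_apply]
      ring
    · exact Ideal.subset_span (by simp)
  · rw [Ideal.span_le]
    rintro _ (rfl | rfl)
    · refine Ideal.mem_span_insert.mpr ⟨X (σ 2, τ 2), _, Ideal.mem_span_pair.mpr
        ⟨-X (σ 1, τ 2), X (σ 0, τ 2), rfl⟩, ?_⟩
      simp only [Matrix.det_fin_three, Matrix.submatrix_apply, Matrix.of_apply]
      ring
    · exact Ideal.subset_span (by simp)
  · intro hle
    let φ : MvPolynomial (Fin 3 × Fin 3) K →+* K :=
      eval fun p => if p = (σ 0, τ 0) ∨ p = (σ 1, τ 2) then 1 else 0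
    have hker := hle.trans (Ideal.span_le (I := RingHom.ker φ).mpr
      (by rintro _ (rfl | rfl | rfl) <;> simp [φ, RingHom.mem_ker]))
    have := hker (Ideal.subset_span (Or.inr (Or.inl rfl)))
    simp [φ, RingHom.mem_ker] at this
  · intro hle
    let φ : MvPolynomial (Fin 3 × Fin 3) K →+* K :=
      eval fun p => if p = (σ 0, τ 0) ∨ p = (σ 2, τ 1) then 1 else 0
    have hker := hle.trans (Ideal.span_le (I := RingHom.ker φ).mpr
      (by rintro _ (rfl | rfl | rfl) <;> simp [φ, RingHom.mem_ker]))
    have := hker (Ideal.subset_span (Or.inr (Or.inl rfl)))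
    simp [φ, RingHom.mem_ker] at this
  · intro J hJ hIJ
    have hdet := hIJ (Ideal.subset_span (Set.mem_insert _ _))
    have hμ := hIJ (Ideal.subset_span (Set.mem_insert_of_mem _ rfl))
    simp only [Matrix.det_fin_three, Matrix.submatrix_apply, Matrix.of_apply] at hdet
    simp only [Ideal.span_le, Set.insert_subset_iff, Set.singleton_subset_iff, SetLike.mem_coe, hμ,
      true_and]
    generalize (X (σ 0, τ 0) : MvPolynomial (Fin 3 × Fin 3) K) = a at *
    generalize (X (σ 0, τ 1) : MvPolynomial (Fin 3 × Fin 3) K) = b at *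
    generalize (X (σ 0, τ 2) : MvPolynomial (Fin 3 × Fin 3) K) = c at *
    generalize (X (σ 1, τ 0) : MvPolynomial (Fin 3 × Fin 3) K) = d at *
    generalize (X (σ 1, τ 1) : MvPolynomial (Fin 3 × Fin 3) K) = f at *
    generalize (X (σ 1, τ 2) : MvPolynomial (Fin 3 × Fin 3) K) = g at *
    generalize (X (σ 2, τ 0) : MvPolynomial (Fin 3 × Fin 3) K) = u at *
    generalize (X (σ 2, τ 1) : MvPolynomial (Fin 3 × Fin 3) K) = v at *
    generalize (X (σ 2, τ 2) : MvPolynomial (Fin 3 × Fin 3) K) = w at *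
    have h₁ : (a * g - c * d) * (a * v - b * u) ∈ J := by
      convert J.sub_mem (J.mul_mem_left (a * w - c * u) hμ) (J.mul_mem_left a hdet) using 1
      ring
    have h₂ : (a * g - c * d) * (d * v - f * u) ∈ J := by
      convert J.sub_mem (J.mul_mem_left (d * w - g * u) hμ) (J.mul_mem_left d hdet) using 1
      ring
    have h₃ : (b * g - c * f) * (a * v - b * u) ∈ J := by
      convert J.sub_mem (J.mul_mem_left (b * w - c * v) hμ) (J.mul_mem_left b hdet) using 1
      ring
    have h₄ : (b * g - c * f) * (d * v - f * u) ∈ J := by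
      convert J.sub_mem (J.mul_mem_left (f * w - g * v) hμ) (J.mul_mem_left f hdet) using 1
      ring
    have := hJ.mem_or_mem h₁
    have := hJ.mem_or_mem h₂
    have := hJ.mem_or_mem h₃
    have := hJ.mem_or_mem h₄
    tauto
end

section
/- Let K be a field and R = MvPolynomial (Fin 3 × Fin 3) K, the polynomial ring in the entries x_{ij} = X (i, j) of a generic 3×3 matrix X, and let Δ = det X ∈ R. Let (i₁, i₂, i₃) and (j₁, j₂, j₃) each be an enumeration of the three elements of Fin 3 (given by permutations of Fin 3), let μ = x_{i₁j₁} x_{i₂j₂} − x_{i₁j₂} x_{i₂j₁}, and let I = Ideal.span {Δ, μ}. Then the image of the variable x_{i₃j₂} in the quotient ring R ⧸ I is not a zero divisor. -/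
open MvPolynomial

namespace MvPolynomial

variable {ι R : Type*} [CommRing R]

theorem X_dvd_sub_aeval_update [DecidableEq ι] (i : ι) (p : MvPolynomial ι R) :
    X i ∣ p - aeval (Function.update (X : ι → MvPolynomial ι R) i 0) p := by
  rw [← Ideal.mem_span_singleton, ← Ideal.Quotient.mk_eq_mk_iff_sub_mem]
  suffices h : Ideal.Quotient.mkₐ R (Ideal.span {X i}) =
      (Ideal.Quotient.mkₐ R (Ideal.span {(X i : MvPolynomial ι R)})).comp
        (aeval (Function.update X i 0)) from DFunLike.congr_fun h p
  ext j
  by_cases hj : j = i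
  · subst hj
    simp
  · simp [hj]

theorem prime_X_mul_X_sub_X_mul_X {K : Type*} [Field K] {a b d e : ι}
    (hab : a ≠ b) (had : a ≠ d) (hae : a ≠ e) (hbe : b ≠ e) (hde : d ≠ e) :
    Prime (X a * X e - X b * X d : MvPolynomial ι K) := by
  classical
  rw [← irreducible_iff_prime,
    show (X a * X e - X b * X d : MvPolynomial ι K) = X e * X a + -(X b * X d) by ring]
  refine irreducible_mul_X_add _ _ _ (X_ne_zero e) (by simpa [vars_X] using hae) ?_ ?_
  · rw [vars_neg]
    intro h
    simpa [vars_X, hab, had] using vars_mul _ _ h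
  · rw [X_prime.irreducible.isRelPrime_iff_not_dvd, dvd_neg, X_dvd_mul_iff, X_dvd_X, X_dvd_X]
    tauto

end MvPolynomial

theorem Ideal.mem_span_pair_of_mul_mem {R : Type*} [CommRing R] [IsDomain R] {h m u v p : R}
    (φ : R →+* R) (hφ : ∀ q, h ∣ q - φ q) (hh0 : h ≠ 0) (hh : φ h = 0) (hm : φ m = m)
    (hv : φ v = v) (hprime : Prime m) (hmv : ¬ m ∣ v)
    (hp : h * p ∈ Ideal.span {m, h * u + v}) : p ∈ Ideal.span {m, h * u + v} := by
  obtain ⟨A, B, hAB⟩ := Ideal.mem_span_pair.1 hp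
  have h0 : φ A * m + φ B * v = 0 := by
    simpa [hh, hm, hv] using congrArg φ hAB
  obtain ⟨C, hC⟩ : m ∣ φ B :=
    (hprime.dvd_or_dvd ⟨-φ A, by linear_combination h0⟩).resolve_right hmv
  have hA : φ A = -(C * v) := mul_right_cancel₀ hprime.ne_zero (by
    rw [hC] at h0
    linear_combination h0)
  obtain ⟨A', hA'⟩ := hφ A
  obtain ⟨B', hB'⟩ := hφ B
  refine Ideal.mem_span_pair.2 ⟨A' + C * u, B', mul_left_cancel₀ hh0 ?_⟩
  linear_combination hAB - m * hA' - (h * u + v) * hB' - m * hA - (h * u + v) * hC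

theorem Matrix.det_submatrix_perm_perm {n R : Type*} [Fintype n] [DecidableEq n] [CommRing R]
    (σ τ : Equiv.Perm n) (M : Matrix n n R) :
    (M.submatrix σ τ).det = (σ.sign * τ.sign : ℤˣ) * M.det := by
  rw [show M.submatrix σ τ = (M.submatrix σ id).submatrix id τ from rfl, Matrix.det_permute',
    Matrix.det_permute]
  push_cast
  ring

/-- The nonzerodivisor claim from the proof of Proposition 3.8: the image of
`x_{i₃ j₂}` in the quotient by `I = (det X, μ)` is not a zero divisor.
Enumerations of rows and columns are given by permutations `σ, τ` of `Fin 3`,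
with `iₖ = σ (k-1)` and `jₖ = τ (k-1)`. -/
theorem stmt_13 (K : Type*) [Field K] (σ τ : Equiv.Perm (Fin 3)) :
    Ideal.Quotient.mk
      (Ideal.span
        {(Matrix.of fun i j : Fin 3 =>
            (X (i, j) : MvPolynomial (Fin 3 × Fin 3) K)).det,
         X (σ 0, τ 0) * X (σ 1, τ 1) - X (σ 0, τ 1) * X (σ 1, τ 0)})
      (X (σ 2, τ 1)) ∈
    nonZeroDivisors (MvPolynomial (Fin 3 × Fin 3) K ⧸
      Ideal.span
        {(Matrix.of fun i j : Fin 3 =>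
            (X (i, j) : MvPolynomial (Fin 3 × Fin 3) K)).det,
         X (σ 0, τ 0) * X (σ 1, τ 1) - X (σ 0, τ 1) * X (σ 1, τ 0)}) := by
  set M : Matrix (Fin 3) (Fin 3) (MvPolynomial (Fin 3 × Fin 3) K) :=
    Matrix.of fun i j => X (i, j) with hM
  set m : MvPolynomial (Fin 3 × Fin 3) K :=
    X (σ 0, τ 0) * X (σ 1, τ 1) - X (σ 0, τ 1) * X (σ 1, τ 0) with hm
  let u : MvPolynomial (Fin 3 × Fin 3) K :=
    X (σ 0, τ 2) * X (σ 1, τ 0) - X (σ 0, τ 0) * X (σ 1, τ 2)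
  let v : MvPolynomial (Fin 3 × Fin 3) K :=
    X (σ 2, τ 0) * (X (σ 0, τ 1) * X (σ 1, τ 2) - X (σ 0, τ 2) * X (σ 1, τ 1))
  have hspan : Ideal.span {M.det, m} = Ideal.span {m, X (σ 2, τ 1) * u + v} := by
    have hdet := Matrix.det_submatrix_perm_perm σ τ M
    rw [Matrix.det_fin_three] at hdet
    simp only [hM, Matrix.submatrix_apply, Matrix.of_apply] at hdet
    rw [← hM] at hdet
    rcases Int.units_eq_one_or (σ.sign * τ.sign) with hs | hs <;>
      simp only [hs, Units.val_one, Units.val_neg, Int.cast_one, Int.cast_neg] at hdet <;>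
      ext q <;> simp only [Ideal.mem_span_pair] <;> constructor <;> rintro ⟨A, B, rfl⟩
    · exact ⟨A * X (σ 2, τ 2) + B, A, by linear_combination A * hdet⟩
    · exact ⟨B, A - B * X (σ 2, τ 2), by linear_combination -B * hdet⟩
    · exact ⟨-A * X (σ 2, τ 2) + B, -A, by linear_combination -A * hdet⟩
    · exact ⟨-B, A - B * X (σ 2, τ 2), by linear_combination -B * hdet⟩
  have hprime : Prime m := by
    apply prime_X_mul_X_sub_X_mul_X <;> simp
  have hmv : ¬ m ∣ v := by
    rintro ⟨q, hq⟩
    have h := congrArg (eval fun x : Fin 3 × Fin 3 =>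
      if x = (σ 2, τ 0) ∨ x = (σ 0, τ 1) ∨ x = (σ 1, τ 2) then (1 : K) else 0) hq
    simp [m, v] at h
  rw [hspan, mem_nonZeroDivisors_iff_right]
  intro x hx
  obtain ⟨p, rfl⟩ := Ideal.Quotient.mk_surjective x
  rw [← map_mul, Ideal.Quotient.eq_zero_iff_mem, mul_comm p] at hx
  rw [Ideal.Quotient.eq_zero_iff_mem]
  refine Ideal.mem_span_pair_of_mul_mem
    (aeval (Function.update (X : Fin 3 × Fin 3 → MvPolynomial (Fin 3 × Fin 3) K)
      (σ 2, τ 1) 0)).toRingHom (X_dvd_sub_aeval_update _) (X_ne_zero _) ?_ ?_ ?_ hprime hmv hx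
  · simp
  · simp [m]
  · simp [v]
end
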